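/- arXiv:1103.2726 — 8 statements merged into one kernel-verified Lean document; each statement's English description precedes it below -/
import Mathlib

section
/- Fix an integer r ≥ 2. If a word w = (w_1,…,w_j) belongs to the set Exc of exceptional words, then for every 1 ≤ i ≤ j the prefix (w_1,…,w_i) consisting of the first i letters of w also belongs to Exc. -/
/-- The substitution `g` on words over the alphabet `{r-1, r}`:
the letter `r` is sent to `r-1` copies of `r` followed by one `r-1`,
and the letter `r-1` is sent to `r-2` copies of `r` followed by one `r-1`;
`g` is extended to words by concatenation. -/
def gW (r : ℕ) (l : List ℕ) : List ℕ :=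
  l.flatMap fun w =>
    if w = r then List.replicate (r - 1) r ++ [r - 1]
    else List.replicate (r - 2) r ++ [r - 1]

/-- The set of exceptional words:
`Exc = { g^{s₁}(r) ⋯ g^{s_j}(r) : j ≥ 1, s₁, …, s_j ≥ 0 }`. -/
def Exc (r : ℕ) : Set (List ℕ) :=
  { w | ∃ s : List ℕ, s ≠ [] ∧ w = (s.map fun k => (gW r)^[k] [r]).flatten }

theorem gW_iterate_append (r k : ℕ) (u v : List ℕ) :
    (gW r)^[k] (u ++ v) = (gW r)^[k] u ++ (gW r)^[k] v := by
  induction k generalizing u v with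
  | zero => rfl
  | succ k ih =>
    rw [Function.iterate_succ_apply, Function.iterate_succ_apply, Function.iterate_succ_apply,
      ← ih, gW, List.flatMap_append]
    rfl

theorem gW_iterate_nil (r k : ℕ) : (gW r)^[k] [] = [] :=
  Function.iterate_fixed rfl k

theorem exists_gW_singleton (r a : ℕ) :
    ∃ n, gW r [a] = List.replicate n r ++ [r - 1] := by
  by_cases h : a = r
  · exact ⟨r - 1, by simp [gW, h]⟩
  · exact ⟨r - 2, by simp [gW, h]⟩

/-- Possibly empty products of the words `g^s(r)`. -/
def ExcOrNil (r : ℕ) (w : List ℕ) : Prop :=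
  ∃ s : List ℕ, w = (s.map fun k => (gW r)^[k] [r]).flatten

theorem ExcOrNil.nil (r : ℕ) : ExcOrNil r [] := ⟨[], rfl⟩

theorem ExcOrNil.append {r : ℕ} {u v : List ℕ} (hu : ExcOrNil r u) (hv : ExcOrNil r v) :
    ExcOrNil r (u ++ v) := by
  obtain ⟨s, rfl⟩ := hu
  obtain ⟨t, rfl⟩ := hv
  exact ⟨s ++ t, by simp⟩

theorem ExcOrNil.iterate (r k : ℕ) : ExcOrNil r ((gW r)^[k] [r]) := ⟨[k], by simp⟩

theorem ExcOrNil.mem_Exc {r : ℕ} {w : List ℕ} (h : ExcOrNil r w) (hw : w ≠ []) :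
    w ∈ Exc r := by
  obtain ⟨s, rfl⟩ := h
  exact ⟨s, by rintro rfl; exact hw rfl, rfl⟩

/-- Every proper prefix of `w` is a possibly empty product of words `g^s(r)`. -/
def ProperPrefixesExc (r : ℕ) (w : List ℕ) : Prop :=
  ∀ p, p <+: w → p ≠ w → ExcOrNil r p

theorem ProperPrefixesExc.nil (r : ℕ) : ProperPrefixesExc r [] :=
  fun _ hp hne => absurd (List.prefix_nil.mp hp) hne

theorem ProperPrefixesExc.append {r : ℕ} {u v : List ℕ} (hu : ProperPrefixesExc r u)
    (hu' : ExcOrNil r u) (hv : ProperPrefixesExc r v) : ProperPrefixesExc r (u ++ v) := by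
  rintro p ⟨t, ht⟩ hne
  rcases List.append_eq_append_iff.mp ht with ⟨a, rfl, -⟩ | ⟨c, rfl, rfl⟩
  · by_cases h : p = p ++ a
    · rwa [h]
    · exact hu p (List.prefix_append p a) h
  · exact hu'.append (hv c (List.prefix_append c t) fun h => hne (congrArg (u ++ ·) h))

theorem excOrNil_iterate_replicate (r k n : ℕ)
    (h : ProperPrefixesExc r ((gW r)^[k] [r])) :
    ExcOrNil r ((gW r)^[k] (List.replicate n r)) ∧
      ProperPrefixesExc r ((gW r)^[k] (List.replicate n r)) := by
  induction n with
  | zero =>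
    rw [List.replicate_zero, gW_iterate_nil]
    exact ⟨.nil r, .nil r⟩
  | succ n ih =>
    rw [List.replicate_succ, ← List.singleton_append, gW_iterate_append]
    exact ⟨(ExcOrNil.iterate r k).append ih.1, h.append (ExcOrNil.iterate r k) ih.2⟩

theorem properPrefixesExc_iterate (r k a : ℕ) : ProperPrefixesExc r ((gW r)^[k] [a]) := by
  induction k generalizing a with
  | zero =>
    intro p hp hne
    obtain rfl : p = [] := by
      rcases List.prefix_cons_iff.mp hp with h | ⟨t, rfl, ht⟩
      · exact h
      · exact absurd (by rw [List.prefix_nil.mp ht]; rfl) hne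
    exact .nil r
  | succ k ih =>
    obtain ⟨n, hn⟩ := exists_gW_singleton r a
    rw [Function.iterate_succ_apply, hn, gW_iterate_append]
    obtain ⟨h₁, h₂⟩ := excOrNil_iterate_replicate r k n (ih r)
    exact h₂.append h₁ (ih (r - 1))

theorem ExcOrNil.properPrefixesExc {r : ℕ} {w : List ℕ} (h : ExcOrNil r w) :
    ProperPrefixesExc r w := by
  obtain ⟨s, rfl⟩ := h
  induction s with
  | nil => exact .nil r
  | cons k s ih =>
    exact (properPrefixesExc_iterate r k r).append (ExcOrNil.iterate r k) ih

/-- Any nonempty prefix of an exceptional word is exceptional. -/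
theorem stmt2 (r : ℕ) (hr : 2 ≤ r) (w : List ℕ) (hw : w ∈ Exc r)
    (i : ℕ) (hi1 : 1 ≤ i) (hi2 : i ≤ w.length) :
    w.take i ∈ Exc r := by
  obtain ⟨s, -, hs⟩ := hw
  have h : ExcOrNil r w := ⟨s, hs⟩
  have hi : ExcOrNil r (w.take i) := by
    by_cases hiw : w.take i = w
    · rwa [hiw]
    · exact h.properPrefixesExc _ (List.take_prefix i w) hiw
  refine hi.mem_Exc fun h0 => ?_
  have := congrArg List.length h0
  rw [List.length_take, List.length_nil] at this
  omega
end

section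
/- Fix an integer r ≥ 2. For every n ≥ 3, 1 + ∑_{i=1}^{c_{n−1}} b_{n−1,i} = c_n; in particular, the word B_n produced by the recursive construction has exactly c_n letters. -/
/-- Appending `k` terms equal to `r` to a partial sum adds `k * r`. -/
lemma sum_Icc_add_of_eq (g : ℕ → ℕ) (r m : ℕ) :
    ∀ k : ℕ, (∀ p, m + 1 ≤ p → p ≤ m + k → g p = r) →
      ∑ i ∈ Finset.Icc 1 (m + k), g i = ∑ i ∈ Finset.Icc 1 m, g i + k * r := by
  intro k
  induction k with
  | zero => simp
  | succ k ih =>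
    intro h
    rw [← add_assoc, Finset.sum_Icc_succ_top (by omega),
      ih fun p h₁ h₂ => h p h₁ (by omega), h (m + k + 1) (by omega) (by omega)]
    ring

/-- If `g` is the word obtained from `f` by replacing each letter `w` with `w - 1` letters `r`
followed by `r - 1`, and prepending `r - 1`, then the image of the first `j` letters of `f`
contains `1 + j` letters `r - 1`, all other letters being `r`. -/
lemma sum_substituted_word (r N : ℕ) (hr : 2 ≤ r) (f g : ℕ → ℕ)
    (hf : ∀ i, 1 ≤ i → i ≤ N → 1 ≤ f i) (h_first : g 1 = r - 1)
    (h_block : ∀ j : ℕ, 1 ≤ j → j ≤ N → ∀ p : ℕ,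
      2 + ∑ i ∈ Finset.Icc 1 (j - 1), f i ≤ p → p ≤ ∑ i ∈ Finset.Icc 1 j, f i → g p = r)
    (h_end : ∀ j : ℕ, 1 ≤ j → j ≤ N → g (1 + ∑ i ∈ Finset.Icc 1 j, f i) = r - 1) :
    ∀ j ≤ N,
      ∑ i ∈ Finset.Icc 1 (1 + ∑ i ∈ Finset.Icc 1 j, f i), g i + (1 + j)
        = r * (1 + ∑ i ∈ Finset.Icc 1 j, f i) ∧
      ∀ p, 1 ≤ p → p ≤ 1 + ∑ i ∈ Finset.Icc 1 j, f i → 1 ≤ g p := by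
  intro j
  induction j with
  | zero =>
    intro _
    refine ⟨by simp [h_first]; omega, fun p h₁ h₂ => ?_⟩
    obtain rfl : p = 1 := by simp at h₂; omega
    omega
  | succ j ih =>
    intro hj
    obtain ⟨h_sum, h_pos⟩ := ih (by omega)
    have hb := h_block (j + 1) (by omega) hj
    have he := h_end (j + 1) (by omega) hj
    have hS : ∑ i ∈ Finset.Icc 1 (j + 1), f i = ∑ i ∈ Finset.Icc 1 j, f i + f (j + 1) :=
      Finset.sum_Icc_succ_top (by omega) f
    rw [Nat.add_sub_cancel] at hb
    rw [hS] at hb he ⊢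
    generalize ∑ i ∈ Finset.Icc 1 j, f i = S at *
    obtain ⟨k, hk⟩ : ∃ k, f (j + 1) = k + 1 :=
      ⟨f (j + 1) - 1, by have := hf (j + 1) (by omega) hj; omega⟩
    rw [hk] at hb he ⊢
    constructor
    · have hs := sum_Icc_add_of_eq g r (1 + S) k fun p h₁ h₂ => hb p (by omega) (by omega)
      rw [show 1 + (S + (k + 1)) = 1 + S + k + 1 by ring] at he ⊢
      rw [Finset.sum_Icc_succ_top (by omega), hs, he]
      obtain ⟨q, rfl⟩ : ∃ q, r = q + 1 := ⟨r - 1, by omega⟩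
      rw [Nat.add_sub_cancel]
      linarith
    · intro p h₁ h₂
      by_cases hp : p ≤ 1 + S
      · exact h_pos p h₁ hp
      · by_cases hp' : p ≤ S + (k + 1)
        · rw [hb p (by omega) hp']
          omega
        · obtain rfl : p = 1 + (S + (k + 1)) := by omega
          omega


/-- With `c 1 = 0`, `c 2 = 1`, `c n = r c (n-1) - c (n-2)` and the words
`B_n = (b n 1, …, b n (c n))` defined by `b 2 1 = r - 1` and, for `n ≥ 3`,
`b n 1 = r-1`, `b n p = r` for `2 + ∑_{i<j} b (n-1) i ≤ p ≤ ∑_{i≤j} b (n-1) i`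
and `b n (1 + ∑_{i≤j} b (n-1) i) = r - 1` for each `1 ≤ j ≤ c (n-1)`, we have
`1 + ∑_{i=1}^{c (n-1)} b (n-1) i = c n` for all `n ≥ 3`. -/
theorem stmt3 (r : ℕ) (hr : 2 ≤ r) (c : ℕ → ℕ)
    (hc1 : c 1 = 0) (hc2 : c 2 = 1)
    (hcrec : ∀ n : ℕ, 3 ≤ n → (c n : ℤ) = r * c (n - 1) - c (n - 2))
    (b : ℕ → ℕ → ℕ)
    (hb2 : b 2 1 = r - 1)
    (hb1 : ∀ n : ℕ, 3 ≤ n → b n 1 = r - 1)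
    (hbr : ∀ n : ℕ, 3 ≤ n → ∀ j : ℕ, 1 ≤ j → j ≤ c (n - 1) → ∀ p : ℕ,
      2 + ∑ i ∈ Finset.Icc 1 (j - 1), b (n - 1) i ≤ p →
      p ≤ ∑ i ∈ Finset.Icc 1 j, b (n - 1) i → b n p = r)
    (hbe : ∀ n : ℕ, 3 ≤ n → ∀ j : ℕ, 1 ≤ j → j ≤ c (n - 1) →
      b n (1 + ∑ i ∈ Finset.Icc 1 j, b (n - 1) i) = r - 1) :
    ∀ n : ℕ, 3 ≤ n → 1 + ∑ i ∈ Finset.Icc 1 (c (n - 1)), b (n - 1) i = c n := by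
  suffices h : ∀ n : ℕ, 3 ≤ n →
      1 + ∑ i ∈ Finset.Icc 1 (c (n - 1)), b (n - 1) i = c n ∧
      ∀ p, 1 ≤ p → p ≤ c (n - 1) → 1 ≤ b (n - 1) p from fun n hn => (h n hn).1
  intro n hn
  induction n, hn using Nat.le_induction with
  | base =>
    have h₃ := hcrec 3 le_rfl
    norm_num [hc1, hc2] at h₃ ⊢
    refine ⟨by omega, fun p h₁ h₂ => ?_⟩
    obtain rfl : p = 1 := by omega
    omega
  | succ n hn ih =>
    obtain ⟨h_len, h_pos⟩ := ih
    obtain ⟨h_sum, h_pos'⟩ := sum_substituted_word r (c (n - 1)) hr (b (n - 1)) (b n) h_pos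
      (hb1 n hn) (hbr n hn) (hbe n hn) (c (n - 1)) le_rfl
    rw [h_len] at h_sum h_pos'
    rw [Nat.add_sub_cancel]
    refine ⟨?_, h_pos'⟩
    have h_rec := hcrec (n + 1) (by omega)
    rw [Nat.add_sub_cancel, show n + 1 - 2 = n - 1 by omega] at h_rec
    zify at h_sum ⊢
    linarith
end

section
/- Fix an integer r ≥ 2. For every n ≥ 3, the word B_n equals the one-letter word (r−1) followed by g(B_{n−1}); that is, (b_{n,1},…,b_{n,c_n}) = (r−1) · g(b_{n−1,1}) g(b_{n−1,2}) ⋯ g(b_{n−1,c_{n−1}}). -/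
/-- The `g`-image of a letter `k ∈ {r-1, r}` is `k - 1` copies of `r` followed by `r - 1`. -/
theorem gW_append_singleton (r : ℕ) (hr : 2 ≤ r) (l : List ℕ) (k : ℕ) (hk : k = r - 1 ∨ k = r) :
    gW r (l ++ [k]) = gW r l ++ (List.replicate (k - 1) r ++ [r - 1]) := by
  rcases hk with rfl | rfl
  · have h : r - 1 ≠ r := by omega
    have h' : r - 1 - 1 = r - 2 := by omega
    simp [gW, h, h']
  · simp [gW]

theorem mem_gW (r : ℕ) (l : List ℕ) (w : ℕ) (hw : w ∈ gW r l) : w = r - 1 ∨ w = r := by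
  simp only [gW, List.mem_flatMap] at hw
  obtain ⟨k, -, hw⟩ := hw
  split_ifs at hw <;> simp only [List.mem_append, List.mem_replicate, List.mem_singleton] at hw <;>
    tauto

theorem sum_gW_add_length (r : ℕ) (hr : 2 ≤ r) (l : List ℕ) (hl : ∀ w ∈ l, w = r - 1 ∨ w = r) :
    (gW r l).sum + l.length = r * l.sum := by
  induction l using List.reverseRecOn with
  | nil => simp [gW]
  | append_singleton l k ih =>
    have hk : k = r - 1 ∨ k = r := hl k (by simp)
    have ih' := ih fun w hw => hl w (by simp [hw])
    rw [gW_append_singleton r hr l k hk]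
    simp only [List.sum_append, List.sum_replicate, List.sum_singleton, List.length_append,
      List.length_singleton, smul_eq_mul, mul_add, ← ih']
    obtain ⟨k, rfl⟩ : ∃ k', k = k' + 1 := ⟨k - 1, by omega⟩
    obtain ⟨r, rfl⟩ : ∃ r', r = r' + 1 := ⟨r - 1, by omega⟩
    simp only [Nat.add_sub_cancel]
    ring

theorem sum_map_range_succ (v : ℕ → ℕ) (m : ℕ) :
    ((List.range m).map fun i => v (i + 1)).sum = ∑ i ∈ Finset.Icc 1 m, v i := by
  induction m with
  | zero => simp
  | succ m ih =>
    rw [Finset.sum_Icc_succ_top (by omega), List.range_succ]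
    simp [ih]

/-- A word `u` obtained from a word `v` by the block rule is `r - 1` followed by `g v`. -/
theorem map_range_eq_cons_gW (r : ℕ) (hr : 2 ≤ r) (u v : ℕ → ℕ) (m : ℕ)
    (hv : ∀ w ∈ (List.range m).map (fun i => v (i + 1)), w = r - 1 ∨ w = r)
    (h1 : u 1 = r - 1)
    (hur : ∀ j : ℕ, 1 ≤ j → j ≤ m → ∀ p : ℕ, 2 + ∑ i ∈ Finset.Icc 1 (j - 1), v i ≤ p →
      p ≤ ∑ i ∈ Finset.Icc 1 j, v i → u p = r)
    (hue : ∀ j : ℕ, 1 ≤ j → j ≤ m → u (1 + ∑ i ∈ Finset.Icc 1 j, v i) = r - 1) :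
    (List.range (1 + ∑ i ∈ Finset.Icc 1 m, v i)).map (fun i => u (i + 1)) =
      (r - 1) :: gW r ((List.range m).map fun i => v (i + 1)) := by
  induction m with
  | zero => simp [gW, h1]
  | succ m ih =>
    have ih' := ih (fun w hw => hv w (by rw [List.range_succ]; simp only [List.map_append,
      List.mem_append, hw, true_or])) (fun j hj hjm => hur j hj (by omega))
      (fun j hj hjm => hue j hj (by omega))
    have hk : v (m + 1) = r - 1 ∨ v (m + 1) = r :=
      hv _ (List.mem_map.2 ⟨m, by simp, rfl⟩)
    have hr' := hur (m + 1) (by omega) le_rfl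
    have he' := hue (m + 1) (by omega) le_rfl
    rw [Finset.sum_Icc_succ_top (by omega)] at hr' he' ⊢
    rw [Nat.add_sub_cancel] at hr'
    rw [List.range_succ (n := m), List.map_append, List.map_singleton,
      gW_append_singleton r hr _ _ hk, ← add_assoc, List.range_add, List.map_append, ih',
      List.cons_append]
    congr 2
    obtain ⟨k, hk'⟩ : ∃ k, v (m + 1) = k + 1 := ⟨v (m + 1) - 1, by omega⟩
    rw [hk'] at hr' he' ⊢
    rw [List.range_succ, List.map_append, List.map_append, Nat.add_sub_cancel]
    congr 1
    · rw [List.eq_replicate_iff]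
      refine ⟨by simp, fun w hw => ?_⟩
      simp only [List.mem_map, List.mem_range, exists_exists_and_eq_and] at hw
      obtain ⟨i, hi, rfl⟩ := hw
      exact hr' _ (by omega) (by omega)
    · simp only [List.map_singleton, List.cons.injEq, and_true]
      rw [← he']
      congr 1
      ring

/-- For `n ≥ 3` the word `B_n = (b n 1, …, b n (c n))` equals the letter `r-1`
followed by `g(B_{n-1})`. -/
theorem stmt4 (r : ℕ) (hr : 2 ≤ r) (c : ℕ → ℕ)
    (hc1 : c 1 = 0) (hc2 : c 2 = 1)
    (hcrec : ∀ n : ℕ, 3 ≤ n → (c n : ℤ) = r * c (n - 1) - c (n - 2))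
    (b : ℕ → ℕ → ℕ)
    (hb2 : b 2 1 = r - 1)
    (hb1 : ∀ n : ℕ, 3 ≤ n → b n 1 = r - 1)
    (hbr : ∀ n : ℕ, 3 ≤ n → ∀ j : ℕ, 1 ≤ j → j ≤ c (n - 1) → ∀ p : ℕ,
      2 + ∑ i ∈ Finset.Icc 1 (j - 1), b (n - 1) i ≤ p →
      p ≤ ∑ i ∈ Finset.Icc 1 j, b (n - 1) i → b n p = r)
    (hbe : ∀ n : ℕ, 3 ≤ n → ∀ j : ℕ, 1 ≤ j → j ≤ c (n - 1) →
      b n (1 + ∑ i ∈ Finset.Icc 1 j, b (n - 1) i) = r - 1) :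
    ∀ n : ℕ, 3 ≤ n →
      (List.range (c n)).map (fun i => b n (i + 1)) =
        (r - 1) :: gW r ((List.range (c (n - 1))).map (fun i => b (n - 1) (i + 1))) := by
  have word_eq : ∀ n : ℕ, 2 ≤ n →
      (∀ w ∈ (List.range (c n)).map (fun i => b n (i + 1)), w = r - 1 ∨ w = r) →
      c (n + 1) = 1 + ∑ i ∈ Finset.Icc 1 (c n), b n i →
      (List.range (c (n + 1))).map (fun i => b (n + 1) (i + 1)) =
        (r - 1) :: gW r ((List.range (c n)).map (fun i => b n (i + 1))) := by
    intro n hn hw hc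
    rw [hc]
    exact map_range_eq_cons_gW r hr (b (n + 1)) (b n) (c n) hw (hb1 (n + 1) (by omega))
      (hbr (n + 1) (by omega)) (hbe (n + 1) (by omega))
  have letters_and_length : ∀ n : ℕ, 2 ≤ n →
      (∀ w ∈ (List.range (c n)).map (fun i => b n (i + 1)), w = r - 1 ∨ w = r) ∧
      c (n + 1) = 1 + ∑ i ∈ Finset.Icc 1 (c n), b n i := by
    intro n hn
    induction n, hn using Nat.le_induction with
    | base =>
      have h3 := hcrec 3 le_rfl
      simp only [Nat.reduceSub, hc1, hc2] at h3
      refine ⟨by simp [hc2, hb2], ?_⟩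
      simp only [Nat.reduceAdd, hc2, Finset.Icc_self, Finset.sum_singleton, hb2]
      push_cast at h3
      omega
    | succ n hn ih =>
      obtain ⟨hw, hc⟩ := ih
      have hW := word_eq n hn hw hc
      refine ⟨fun w h => ?_, ?_⟩
      · rw [hW, List.mem_cons] at h
        exact h.elim Or.inl (mem_gW r _ w)
      · have hs := sum_gW_add_length r hr _ hw
        have hrec := hcrec (n + 2) (by omega)
        rw [show n + 2 - 1 = n + 1 by omega, Nat.add_sub_cancel] at hrec
        rw [← sum_map_range_succ, hW, List.sum_cons]
        rw [sum_map_range_succ, List.length_map, List.length_range] at hs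
        have hmul : r * c (n + 1) = r + r * ∑ i ∈ Finset.Icc 1 (c n), b n i := by
          rw [hc]; ring
        rw [← Nat.cast_mul, hmul, ← hs] at hrec
        change c (n + 2) = _
        generalize (gW r _).sum = t at hrec ⊢
        push_cast at hrec
        omega
  intro n hn
  obtain ⟨n, rfl⟩ : ∃ k, n = k + 1 := ⟨n - 1, by omega⟩
  obtain ⟨hw, hc⟩ := letters_and_length n (by omega)
  exact word_eq n (by omega) hw hc
end

section
/- Let F₂ be the free group on two generators x and y, fix an integer r ≥ 2, and let G : F₂ → F₂ be the group endomorphism with G(x) = x y x⁻¹ and G(y) = y^r x⁻¹. Then for every n ≥ 1, the element z_n := G^n(x) of F₂ equals x · y · (∏_{i=1}^{c_n} x⁻¹ y^{b_{n,i}}) · x⁻¹, where the product is taken in order i = 1, …, c_n and is empty when n = 1 (since c_1 = 0). -/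
/-- The substitution taking the exponent word of `G^n x` to that of `G^(n+1) x`. -/
def exponentSubst (r : ℕ) (L : List ℕ) : List ℕ :=
  (r - 1) :: L.flatMap (fun a => List.replicate (a - 1) r ++ [r - 1])

theorem exponentSubst_concat (r : ℕ) (L : List ℕ) (a : ℕ) :
    exponentSubst r (L ++ [a]) =
      exponentSubst r L ++ (List.replicate (a - 1) r ++ [r - 1]) := by
  simp [exponentSubst]

theorem one_le_of_mem_exponentSubst {r : ℕ} (hr : 2 ≤ r) {L : List ℕ} {a : ℕ}
    (ha : a ∈ exponentSubst r L) : 1 ≤ a := by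
  simp only [exponentSubst, List.mem_cons, List.mem_flatMap, List.mem_append,
    List.mem_replicate, List.not_mem_nil, or_false] at ha
  rcases ha with h | ⟨_, _, ⟨_, h⟩ | h⟩ <;> omega

theorem sum_exponentSubst {r : ℕ} (hr : 2 ≤ r) (L : List ℕ) (hL : ∀ a ∈ L, 1 ≤ a) :
    (exponentSubst r L).sum + 1 + L.length = r * (L.sum + 1) := by
  induction L using List.reverseRecOn with
  | nil => simp [exponentSubst]; omega
  | append_singleton L a ih =>
    have h := ih fun b hb => hL b (by simp [hb])
    obtain ⟨m, rfl⟩ : ∃ m, a = m + 1 := ⟨a - 1, by have := hL a (by simp); omega⟩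
    obtain ⟨s, rfl⟩ : ∃ s, r = s + 1 := ⟨r - 1, by omega⟩
    rw [exponentSubst_concat]
    simp at h ⊢
    linarith

theorem sum_Icc_one_eq_sum_map_range (a : ℕ → ℕ) (k : ℕ) :
    ∑ i ∈ Finset.Icc 1 k, a i = ((List.range k).map fun i => a (i + 1)).sum := by
  induction k with
  | zero => simp
  | succ k ih => rw [Finset.sum_Icc_succ_top (by omega), ih, List.range_succ]; simp

theorem map_range_eq_exponentSubst {r : ℕ} (a f : ℕ → ℕ) (k : ℕ)
    (ha : ∀ j, 1 ≤ j → j ≤ k → 1 ≤ a j) (h1 : f 1 = r - 1)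
    (hbr : ∀ j, 1 ≤ j → j ≤ k → ∀ p, 2 + ∑ i ∈ Finset.Icc 1 (j - 1), a i ≤ p →
      p ≤ ∑ i ∈ Finset.Icc 1 j, a i → f p = r)
    (hbe : ∀ j, 1 ≤ j → j ≤ k → f (1 + ∑ i ∈ Finset.Icc 1 j, a i) = r - 1) :
    (List.range (1 + ∑ i ∈ Finset.Icc 1 k, a i)).map (fun i => f (i + 1)) =
      exponentSubst r ((List.range k).map fun i => a (i + 1)) := by
  induction k with
  | zero => simp [exponentSubst, h1]
  | succ k ih =>
    have ih' := ih (fun j h h' => ha j h (by omega)) (fun j h h' => hbr j h (by omega))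
      (fun j h h' => hbe j h (by omega))
    have hk := ha (k + 1) (by omega) le_rfl
    have hr' := hbr (k + 1) (by omega) le_rfl
    have he := hbe (k + 1) (by omega) le_rfl
    rw [Finset.sum_Icc_succ_top (by omega)] at hr' he ⊢
    rw [Nat.add_sub_cancel] at hr'
    rw [List.range_succ (n := k), List.map_append, List.map_singleton, exponentSubst_concat, ← ih',
      ← add_assoc, List.range_add, List.map_append]
    congr 1
    obtain ⟨m, hm⟩ : ∃ m, a (k + 1) = m + 1 := ⟨a (k + 1) - 1, by omega⟩
    rw [hm] at hr' he ⊢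
    rw [List.range_succ]
    simp only [List.map_append, List.map_map, List.map_singleton, Nat.add_sub_cancel]
    congr 1
    · rw [List.eq_replicate_iff]
      refine ⟨by simp, ?_⟩
      intro b hb
      simp only [List.mem_map, List.mem_range, Function.comp_apply] at hb
      obtain ⟨i, hi, rfl⟩ := hb
      exact hr' _ (by omega) (by omega)
    · rw [← he]
      congr 2
      ring

theorem map_prod_eq_prod_exponentSubst {H : Type*} [Group H] {r : ℕ} (hr : 2 ≤ r) (x y : H)
    (G : H →* H) (hGx : G x = x * y * x⁻¹) (hGy : G y = y ^ r * x⁻¹)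
    (L : List ℕ) (hL : ∀ a ∈ L, 1 ≤ a) :
    G (x * y * (L.map fun a => x⁻¹ * y ^ a).prod * x⁻¹) =
      x * y * ((exponentSubst r L).map fun a => x⁻¹ * y ^ a).prod * x⁻¹ := by
  obtain ⟨s, rfl⟩ : ∃ s, r = s + 1 := ⟨r - 1, by omega⟩
  induction L using List.reverseRecOn with
  | nil => simp [exponentSubst, hGx, hGy, pow_succ, mul_assoc]
  | append_singleton L a ih =>
    have h := ih fun b hb => hL b (by simp [hb])
    obtain ⟨m, rfl⟩ : ∃ m, a = m + 1 := ⟨a - 1, by have := hL a (by simp); omega⟩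
    have hc : (y ^ (s + 1) * x⁻¹) ^ (m + 1) =
        x * ((x⁻¹ * y ^ (s + 1)) ^ m * (x⁻¹ * y ^ (s + 1))) * x⁻¹ := by
      rw [← pow_succ, ← conj_pow]
      group
    have hstep : G (x * (x⁻¹ * y ^ (m + 1)) * x⁻¹) =
        x * ((x⁻¹ * y ^ (s + 1)) ^ m * (x⁻¹ * y ^ s)) * x⁻¹ := by
      rw [mul_inv_cancel_left, map_mul, map_inv, map_pow, hGx, hGy, hc, pow_succ y s]
      group
    have hsplit : x * y * ((L ++ [m + 1]).map fun a => x⁻¹ * y ^ a).prod * x⁻¹ =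
        (x * y * (L.map fun a => x⁻¹ * y ^ a).prod * x⁻¹) * (x * (x⁻¹ * y ^ (m + 1)) * x⁻¹) := by
      simp [mul_assoc]
    rw [hsplit, map_mul, h, hstep, exponentSubst_concat]
    simp [mul_assoc]

/-- With `G` the endomorphism of the free group on `x, y` given by
`G x = x y x⁻¹`, `G y = y^r x⁻¹`, and the sequences `c`, `b` as in the paper,
`z_n := G^n x` equals `x y (∏_{i=1}^{c n} x⁻¹ y^(b n i)) x⁻¹`. -/
theorem stmt6 (r : ℕ) (hr : 2 ≤ r) (c : ℕ → ℕ)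
    (hc1 : c 1 = 0) (hc2 : c 2 = 1)
    (hcrec : ∀ n : ℕ, 3 ≤ n → (c n : ℤ) = r * c (n - 1) - c (n - 2))
    (b : ℕ → ℕ → ℕ)
    (hb2 : b 2 1 = r - 1)
    (hb1 : ∀ n : ℕ, 3 ≤ n → b n 1 = r - 1)
    (hbr : ∀ n : ℕ, 3 ≤ n → ∀ j : ℕ, 1 ≤ j → j ≤ c (n - 1) → ∀ p : ℕ,
      2 + ∑ i ∈ Finset.Icc 1 (j - 1), b (n - 1) i ≤ p →
      p ≤ ∑ i ∈ Finset.Icc 1 j, b (n - 1) i → b n p = r)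
    (hbe : ∀ n : ℕ, 3 ≤ n → ∀ j : ℕ, 1 ≤ j → j ≤ c (n - 1) →
      b n (1 + ∑ i ∈ Finset.Icc 1 j, b (n - 1) i) = r - 1)
    (G : FreeGroup (Fin 2) →* FreeGroup (Fin 2))
    (hGx : G (FreeGroup.of 0) =
      FreeGroup.of 0 * FreeGroup.of 1 * (FreeGroup.of 0)⁻¹)
    (hGy : G (FreeGroup.of 1) =
      (FreeGroup.of 1) ^ r * (FreeGroup.of 0)⁻¹) :
    ∀ n : ℕ, 1 ≤ n →
      (⇑G)^[n] (FreeGroup.of 0) =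
        FreeGroup.of 0 * FreeGroup.of 1 *
          ((List.range (c n)).map
            (fun i => (FreeGroup.of 0)⁻¹ * (FreeGroup.of 1) ^ (b n (i + 1)))).prod *
          (FreeGroup.of 0)⁻¹ := by
 
  have main : ∀ n : ℕ, 1 ≤ n →
      (∀ j, 1 ≤ j → j ≤ c n → 1 ≤ b n j) ∧
      c (n + 1) = 1 + ∑ i ∈ Finset.Icc 1 (c n), b n i ∧
      (⇑G)^[n] (FreeGroup.of 0) =
        FreeGroup.of 0 * FreeGroup.of 1 *
          (((List.range (c n)).map fun i => b n (i + 1)).map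
            fun a => (FreeGroup.of 0)⁻¹ * (FreeGroup.of 1) ^ a).prod *
          (FreeGroup.of 0)⁻¹ := by
    intro n hn
    induction n, hn using Nat.le_induction with
    | base =>
      refine ⟨fun j _ _ => by omega, by simp [hc1, hc2], by simp [hc1, hGx]⟩
    | succ n hn ih =>
      obtain ⟨hpos, hc, hz⟩ := ih
      have hword : (List.range (c (n + 1))).map (fun i => b (n + 1) (i + 1)) =
          exponentSubst r ((List.range (c n)).map fun i => b n (i + 1)) := by
        rw [hc]
        rcases hn.eq_or_lt with rfl | hn'
        · simp [hc1, hb2, exponentSubst]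
        · exact map_range_eq_exponentSubst (b n) (b (n + 1)) (c n) hpos (hb1 (n + 1) (by omega))
            (hbr (n + 1) (by omega)) (hbe (n + 1) (by omega))
      have hL : ∀ a ∈ (List.range (c n)).map (fun i => b n (i + 1)), 1 ≤ a := by
        intro a ha
        simp only [List.mem_map, List.mem_range] at ha
        obtain ⟨i, hi, rfl⟩ := ha
        exact hpos _ (by omega) (by omega)
      refine ⟨?_, ?_, ?_⟩
      · intro j h1 hj
        refine one_le_of_mem_exponentSubst hr (L := (List.range (c n)).map fun i => b n (i + 1)) ?_
        rw [← hword, List.mem_map]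
        exact ⟨j - 1, by rw [List.mem_range]; omega, by rw [Nat.sub_add_cancel h1]⟩
      · have hs := sum_exponentSubst hr _ hL
        rw [← hword, ← sum_Icc_one_eq_sum_map_range, ← sum_Icc_one_eq_sum_map_range,
          List.length_map, List.length_range, add_comm (∑ i ∈ Finset.Icc 1 (c n), b n i) 1, ← hc] at hs
        have hrec := hcrec (n + 1 + 1) (by omega)
        simp only [Nat.add_sub_cancel, show n + 1 + 1 - 2 = n by omega] at hrec
        zify at hs ⊢
        linarith
      · rw [Function.iterate_succ_apply', hz, hword]
        exact map_prod_eq_prod_exponentSubst hr _ _ G hGx hGy _ hL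
  intro n hn
  rw [(main n hn).2.2, List.map_map]
  rfl
end

section
/- Fix an integer r ≥ 2. Let K be the field of fractions of the polynomial ring ℚ[x,y] in two commuting variables, and let u : ℤ → K satisfy u_0 = x, u_1 = y, u_n ≠ 0 for all n ∈ ℤ, and u_{n+1}·u_{n−1} = 1 + u_n^r for all n ∈ ℤ. Then for every n ∈ ℤ, u_n is a Laurent polynomial in x and y with nonnegative integer coefficients: there exists a finitely supported function m : ℤ×ℤ → ℕ such that u_n = ∑_{(a,b)} m(a,b) · x^a y^b in K (where x^a, y^b for a, b ∈ ℤ are powers of the nonzero elements x, y of the field K). -/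
namespace RankTwoPositivity

/-- A word is a list of Booleans, `true` marking a horizontal and `false` a vertical letter. A
configuration is a word, latest letter first, in which every letter is selected or not. -/
abbrev Config := List (Bool × Bool)

/-- Weight of a letter for the matching of horizontal letters with selected vertical letters. -/
def hWeight (r : ℕ) : Bool × Bool → ℤ
  | (true, _) => 1
  | (false, s) => if s then -r else 0

/-- Weight of a letter for the matching of vertical letters with selected horizontal letters. -/
def vWeight (r : ℕ) : Bool × Bool → ℤ
  | (true, s) => if s then -r else 0
  | (false, _) => 1

def hSum (r : ℕ) (q : Config) : ℤ := (q.map (hWeight r)).sum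

def vSum (r : ℕ) (q : Config) : ℤ := (q.map (vWeight r)).sum

@[simp] lemma hSum_nil (r : ℕ) : hSum r [] = 0 := rfl
@[simp] lemma vSum_nil (r : ℕ) : vSum r [] = 0 := rfl
@[simp] lemma hSum_cons (r : ℕ) (x : Bool × Bool) (q : Config) :
    hSum r (x :: q) = hWeight r x + hSum r q := by simp [hSum]
@[simp] lemma vSum_cons (r : ℕ) (x : Bool × Bool) (q : Config) :
    vSum r (x :: q) = vWeight r x + vSum r q := by simp [vSum]
@[simp] lemma hSum_append (r : ℕ) (p q : Config) :
    hSum r (p ++ q) = hSum r p + hSum r q := by simp [hSum]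
@[simp] lemma vSum_append (r : ℕ) (p q : Config) :
    vSum r (p ++ q) = vSum r p + vSum r q := by simp [vSum]

/-- A selected horizontal and a later selected vertical letter conflict if the letters `q`
between them satisfy this condition. -/
def Conflict (r : ℕ) (q : Config) : Prop :=
  ∀ q₁ q₂, q = q₁ ++ q₂ → hSum r q₁ < r ∧ vSum r q₂ < r

def Compatible (r : ℕ) (p : Config) : Prop :=
  ∀ p₂ q p₁, p = p₂ ++ (false, true) :: (q ++ (true, true) :: p₁) → ¬ Conflict r q

lemma exists_split_of_vSum_neg {r : ℕ} (q : Config) (h : vSum r q < 0) :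
    ∃ q₁ q₂, q = q₁ ++ (true, true) :: q₂ ∧ vSum r q₁ < r := by
  induction q using List.reverseRecOn with
  | nil => simp at h
  | append_singleton q x ih =>
    obtain ⟨a, s⟩ := x
    simp only [vSum_append, vSum_cons, vSum_nil] at h
    cases a <;> cases s <;> simp only [vWeight, if_true, Bool.false_eq_true, if_false] at h
    · obtain ⟨q₁, q₂, rfl, h'⟩ := ih (by omega)
      exact ⟨q₁, q₂ ++ [(false, false)], by simp, h'⟩
    · obtain ⟨q₁, q₂, rfl, h'⟩ := ih (by omega)
      exact ⟨q₁, q₂ ++ [(false, true)], by simp, h'⟩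
    · obtain ⟨q₁, q₂, rfl, h'⟩ := ih (by omega)
      exact ⟨q₁, q₂ ++ [(true, false)], by simp, h'⟩
    · exact ⟨q, [], rfl, by omega⟩

lemma exists_split_of_hSum_neg {r : ℕ} (q : Config) (h : hSum r q < 0) :
    ∃ q₂ q₁, q = q₂ ++ (false, true) :: q₁ ∧ hSum r q₁ < r := by
  induction q with
  | nil => simp at h
  | cons x q ih =>
    obtain ⟨a, s⟩ := x
    simp only [hSum_cons] at h
    cases a <;> cases s <;> simp only [hWeight, if_true, Bool.false_eq_true, if_false] at h
    · obtain ⟨q₁, q₂, rfl, h'⟩ := ih (by omega)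
      exact ⟨(false, false) :: q₁, q₂, by simp, h'⟩
    · exact ⟨[], q, rfl, by omega⟩
    · obtain ⟨q₁, q₂, rfl, h'⟩ := ih (by omega)
      exact ⟨(true, false) :: q₁, q₂, by simp, h'⟩
    · obtain ⟨q₁, q₂, rfl, h'⟩ := ih (by omega)
      exact ⟨(true, true) :: q₁, q₂, by simp, h'⟩

lemma exists_initial_conflict {r : ℕ} (q : Config)
    (h : ∀ q₁ q₂, q = q₁ ++ q₂ → hSum r q₁ < r) (hv : vSum r q < r) :
    ∃ q₁, Conflict r q₁ ∧ (q = q₁ ∨ ∃ q₂, q = q₁ ++ (true, true) :: q₂) := by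
  by_cases hc : Conflict r q
  · exact ⟨q, hc, Or.inl rfl⟩
  simp only [Conflict, not_forall] at hc
  obtain ⟨a, b, hab, hc⟩ := hc
  have ha := h a b hab
  have hb : (r : ℤ) ≤ vSum r b := by
    by_contra hb
    exact hc ⟨ha, not_le.mp hb⟩
  have ha' : vSum r a < 0 := by
    rw [hab, vSum_append] at hv
    omega
  obtain ⟨q₁, q₂, rfl, hq₁⟩ := exists_split_of_vSum_neg a ha'
  obtain ⟨q₃, hq₃, hq⟩ := exists_initial_conflict q₁
    (fun c d hcd => h c (d ++ (true, true) :: q₂ ++ b) (by simp [hab, hcd])) hq₁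
  refine ⟨q₃, hq₃, Or.inr ?_⟩
  rcases hq with rfl | ⟨q₄, rfl⟩
  · exact ⟨q₂ ++ b, by simp [hab]⟩
  · exact ⟨q₄ ++ (true, true) :: q₂ ++ b, by simp [hab]⟩
termination_by q.length
decreasing_by simp [hab]

lemma exists_final_conflict {r : ℕ} (q : Config)
    (h : ∀ q₁ q₂, q = q₁ ++ q₂ → vSum r q₂ < r) (hh : hSum r q < r) :
    ∃ q₁, Conflict r q₁ ∧ (q = q₁ ∨ ∃ q₂, q = q₂ ++ (false, true) :: q₁) := by
  by_cases hc : Conflict r q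
  · exact ⟨q, hc, Or.inl rfl⟩
  simp only [Conflict, not_forall] at hc
  obtain ⟨a, b, hab, hc⟩ := hc
  have hb := h a b hab
  have ha : (r : ℤ) ≤ hSum r a := by
    by_contra ha
    exact hc ⟨not_le.mp ha, hb⟩
  have hb' : hSum r b < 0 := by
    rw [hab, hSum_append] at hh
    omega
  obtain ⟨q₂, q₁, rfl, hq₁⟩ := exists_split_of_hSum_neg b hb'
  obtain ⟨q₃, hq₃, hq⟩ := exists_final_conflict q₁
    (fun c d hcd => h (a ++ q₂ ++ (false, true) :: c) d (by simp [hab, hcd])) hq₁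
  refine ⟨q₃, hq₃, Or.inr ?_⟩
  rcases hq with rfl | ⟨q₄, rfl⟩
  · exact ⟨a ++ q₂, by simp [hab]⟩
  · exact ⟨a ++ q₂ ++ (false, true) :: q₄, by simp [hab]⟩
termination_by q.length
decreasing_by simp [hab]; omega

/-- Add a constant to the values in a stack of flagged integers. -/
def shift (c : ℤ) (st : List (Bool × ℤ)) : List (Bool × ℤ) := st.map fun e => (e.1, e.2 + c)

/-- The stack of the horizontal letters `u` not yet matched with selected vertical letters, each
with its selection flag and the `vSum` of the letters after `u`. -/
def hStack (r : ℕ) : Config → List (Bool × ℤ)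
  | [] => []
  | (true, s) :: p => (s, 0) :: shift (vWeight r (true, s)) (hStack r p)
  | (false, s) :: p => shift 1 (if s then (hStack r p).drop r else hStack r p)

/-- The stack of the copies of selected horizontal letters `u`, `r` of each, not yet matched with
vertical letters, with the `hSum` of the letters after `u`. -/
def vStack (r : ℕ) : Config → List ℤ
  | [] => []
  | (true, s) :: p => (if s then List.replicate r 0 else []) ++ (vStack r p).map (· + 1)
  | (false, s) :: p => (vStack r p).tail.map (· + hWeight r (false, s))

def Poppable (r : ℕ) (st : List (Bool × ℤ)) : Prop := ∀ e ∈ st, e.1 = true → (r : ℤ) ≤ e.2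

def HeadLarge (r : ℕ) (st : List ℤ) : Prop := ∀ b ∈ st.head?, (r : ℤ) ≤ b

def HValid (r : ℕ) : Config → Prop
  | [] => True
  | (true, _) :: p => HValid r p
  | (false, s) :: p => HValid r p ∧ (s = true → Poppable r ((hStack r p).take r))

def VValid (r : ℕ) : Config → Prop
  | [] => True
  | (true, _) :: p => VValid r p
  | (false, s) :: p => VValid r p ∧ (s = true → HeadLarge r (vStack r p))

lemma shift_getElem? (c : ℤ) (st : List (Bool × ℤ)) (i : ℕ) :
    (shift c st)[i]? = (st[i]?).map fun e => (e.1, e.2 + c) := by simp [shift]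

lemma exists_of_hStack {r : ℕ} (p : Config) (i : ℕ) (s : Bool) (b : ℤ)
    (h : (hStack r p)[i]? = some (s, b)) :
    ∃ q p₁, p = q ++ (true, s) :: p₁ ∧ b = vSum r q ∧
      ∀ q₁ q₂, q = q₁ ++ q₂ → hSum r q₁ ≤ i := by
  induction p generalizing i b with
  | nil => simp [hStack] at h
  | cons x p ih =>
    have step : ∀ (j : ℕ) (b' : ℤ), (hStack r p)[j]? = some (s, b') →
        b = b' + vWeight r x → (j : ℤ) + hWeight r x ≤ i →
        ∃ q p₁, x :: p = q ++ (true, s) :: p₁ ∧ b = vSum r q ∧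
          ∀ q₁ q₂, q = q₁ ++ q₂ → hSum r q₁ ≤ i := by
      intro j b' hj hb hi
      obtain ⟨q, p₁, rfl, rfl, hq⟩ := ih j b' hj
      refine ⟨x :: q, p₁, by simp, by simp [hb, add_comm], fun q₁ q₂ h12 => ?_⟩
      rcases q₁ with _ | ⟨y, q₁⟩
      · simp
      · simp only [List.cons_append, List.cons.injEq] at h12
        obtain ⟨rfl, h12⟩ := h12
        have := hq q₁ q₂ h12
        simp only [hSum_cons]
        omega
    obtain ⟨a, t⟩ := x
    cases a
    · simp only [hStack, shift_getElem?, Option.map_eq_some_iff, Prod.mk.injEq, Prod.exists] at h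
      obtain ⟨s', b', h, rfl, rfl⟩ := h
      cases t
      · exact step i b' (by simpa using h) (by simp [vWeight]) (by simp [hWeight])
      · exact step (r + i) b' (by simpa using h) (by simp [vWeight]) (by simp [hWeight])
    · rcases i with _ | i
      · simp only [hStack, List.getElem?_cons_zero, Option.some.injEq, Prod.mk.injEq] at h
        obtain ⟨rfl, rfl⟩ := h
        refine ⟨[], p, rfl, rfl, fun q₁ q₂ h12 => ?_⟩
        simp_all
      · simp only [hStack, List.getElem?_cons_succ, shift_getElem?, Option.map_eq_some_iff,
          Prod.mk.injEq, Prod.exists] at h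
        obtain ⟨s', b', h, rfl, rfl⟩ := h
        exact step i b' h rfl (by simp [hWeight])

lemma hStack_append {r : ℕ} (p : Config) (s : Bool) (q : Config) :
    (∃ (i : ℕ) (q₁ q₂ : Config), q = q₁ ++ q₂ ∧ (i : ℤ) ≤ hSum r q₁ ∧
      (hStack r (q ++ (true, s) :: p))[i]? = some (s, vSum r q)) ∨
    (∃ q₂ q₁, q = q₂ ++ (false, true) :: q₁ ∧ ∃ i < r,
      (hStack r (q₁ ++ (true, s) :: p))[i]? = some (s, vSum r q₁)) := by
  induction q with
  | nil => exact Or.inl ⟨0, [], [], by simp [hStack]⟩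
  | cons x q ih =>
    rcases ih with ⟨i, q₁, q₂, h12, hi, hst⟩ | ⟨q₂, q₁, rfl, h⟩
    · have step : ∀ j : ℕ, (j : ℤ) ≤ i + hWeight r x →
          (hStack r (x :: q ++ (true, s) :: p))[j]? = some (s, vSum r (x :: q)) →
          ∃ (i : ℕ) (q₁ q₂ : Config), x :: q = q₁ ++ q₂ ∧ (i : ℤ) ≤ hSum r q₁ ∧
            (hStack r (x :: q ++ (true, s) :: p))[i]? = some (s, vSum r (x :: q)) :=
        fun j hj hs => ⟨j, x :: q₁, q₂, by simp [h12], by simp; omega, hs⟩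
      obtain ⟨a, t⟩ := x
      cases a
      · cases t
        · refine Or.inl (step i (by simp [hWeight]) ?_)
          simp [hStack, shift_getElem?, hst, vWeight, add_comm]
        · rcases lt_or_ge i r with hir | hir
          · exact Or.inr ⟨[], q, rfl, i, hir, hst⟩
          · refine Or.inl (step (i - r) (by simp [hWeight]; omega) ?_)
            simp [hStack, shift_getElem?, Nat.add_sub_of_le hir, hst, vWeight, add_comm]
      · refine Or.inl (step (i + 1) (by simp [hWeight]) ?_)
        simp [hStack, shift_getElem?, hst, add_comm]
    · exact Or.inr ⟨x :: q₂, q₁, rfl, h⟩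

lemma exists_of_vStack {r : ℕ} (p : Config) (i : ℕ) (b : ℤ) (h : (vStack r p)[i]? = some b) :
    ∃ q p₁, p = q ++ (true, true) :: p₁ ∧ b = hSum r q ∧
      (∀ q₁ q₂, q = q₁ ++ q₂ → vSum r q₂ < r) ∧ (i : ℤ) + 1 ≤ r - vSum r q := by
  induction p generalizing i b with
  | nil => simp [vStack] at h
  | cons x p ih =>
    have step : ∀ (j : ℕ) (b' : ℤ), (vStack r p)[j]? = some b' →
        b = b' + hWeight r x → (i : ℤ) + vWeight r x ≤ j →
        ∃ q p₁, x :: p = q ++ (true, true) :: p₁ ∧ b = hSum r q ∧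
          (∀ q₁ q₂, q = q₁ ++ q₂ → vSum r q₂ < r) ∧ (i : ℤ) + 1 ≤ r - vSum r q := by
      intro j b' hj hb hi
      obtain ⟨q, p₁, rfl, rfl, hq, hj'⟩ := ih j b' hj
      refine ⟨x :: q, p₁, by simp, by simp [hb, add_comm], fun q₁ q₂ h12 => ?_,
        by simp; omega⟩
      rcases q₁ with _ | ⟨y, q₁⟩
      · simp only [List.nil_append] at h12
        subst h12
        simp only [vSum_cons]
        omega
      · simp only [List.cons_append, List.cons.injEq] at h12
        exact hq q₁ q₂ h12.2
    obtain ⟨a, t⟩ := x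
    cases a
    · simp only [vStack, List.getElem?_map, List.getElem?_tail, Option.map_eq_some_iff] at h
      obtain ⟨b', h, rfl⟩ := h
      exact step (i + 1) b' h rfl (by simp [vWeight])
    · cases t
      · simp only [vStack, Bool.false_eq_true, if_false, List.nil_append, List.getElem?_map,
          Option.map_eq_some_iff] at h
        obtain ⟨b', h, rfl⟩ := h
        exact step i b' h rfl (by simp [vWeight])
      · rcases lt_or_ge i r with hir | hir
        · simp only [vStack, if_true] at h
          rw [List.getElem?_append_left (by simpa using hir), List.getElem?_replicate,
            if_pos hir, Option.some.injEq] at h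
          refine ⟨[], p, rfl, h.symm, fun q₁ q₂ h12 => ?_, by simp; omega⟩
          simp only [List.nil_eq, List.append_eq_nil_iff] at h12
          simp [h12.2]
          omega
        · simp only [vStack, if_true] at h
          rw [List.getElem?_append_right (by simpa using hir)] at h
          simp only [List.length_replicate, List.getElem?_map, Option.map_eq_some_iff] at h
          obtain ⟨b', h, rfl⟩ := h
          exact step (i - r) b' h rfl (by simp [vWeight]; omega)

lemma vStack_append {r : ℕ} (p q : Config) (h : ∀ q₁ q₂, q = q₁ ++ q₂ → vSum r q₂ < r)
    (i : ℕ) (hi : (i : ℤ) < r - vSum r q) :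
    ∃ q₁ q₂, q = q₁ ++ q₂ ∧ (vStack r (q ++ (true, true) :: p))[i]? = some (hSum r q₁) := by
  induction q generalizing i with
  | nil =>
    refine ⟨[], [], rfl, ?_⟩
    simp only [vSum_nil] at hi
    have hir : i < r := by omega
    simp only [vStack, if_true, List.nil_append]
    rw [List.getElem?_append_left (by simpa using hir), List.getElem?_replicate, if_pos hir]
    rfl
  | cons x q ih =>
    have ih' := ih fun q₁ q₂ h12 => h (x :: q₁) q₂ (by simp [h12])
    simp only [vSum_cons] at hi
    obtain ⟨a, t⟩ := x
    cases a
    · obtain ⟨q₁, q₂, h12, hs⟩ := ih' (i + 1) (by simp [vWeight] at hi; omega)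
      refine ⟨(false, t) :: q₁, q₂, by simp [h12], ?_⟩
      simp [vStack, hs, add_comm]
    · cases t
      · obtain ⟨q₁, q₂, h12, hs⟩ := ih' i (by simp [vWeight] at hi; omega)
        refine ⟨(true, false) :: q₁, q₂, by simp [h12], ?_⟩
        simp [vStack, hs, add_comm, hWeight]
      · rcases lt_or_ge i r with hir | hir
        · refine ⟨[], (true, true) :: q, rfl, ?_⟩
          simp only [vStack, if_true, List.cons_append]
          rw [List.getElem?_append_left (by simpa using hir), List.getElem?_replicate,
            if_pos hir]
          rfl
        · obtain ⟨q₁, q₂, h12, hs⟩ := ih' (i - r) (by simp [vWeight] at hi; omega)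
          refine ⟨(true, true) :: q₁, q₂, by simp [h12], ?_⟩
          simp only [vStack, if_true, List.cons_append]
          rw [List.getElem?_append_right (by simpa using hir)]
          simp [hs, add_comm, hWeight]

lemma Compatible.of_cons {r : ℕ} {x : Bool × Bool} {p : Config} (h : Compatible r (x :: p)) :
    Compatible r p :=
  fun p₂ q p₁ hp => h (x :: p₂) q p₁ (by simp [hp])

lemma Compatible.cons {r : ℕ} {x : Bool × Bool} {p : Config} (h : Compatible r p)
    (hx : x = (false, true) → ∀ q p₁, p = q ++ (true, true) :: p₁ → ¬ Conflict r q) :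
    Compatible r (x :: p) := by
  intro p₂ q p₁ hp
  rcases p₂ with _ | ⟨y, p₂⟩
  · simp only [List.nil_append, List.cons.injEq] at hp
    exact hx hp.1 q p₁ hp.2
  · simp only [List.cons_append, List.cons.injEq] at hp
    exact h p₂ q p₁ hp.2

lemma HValid.of_append {r : ℕ} (p₂ p : Config) (h : HValid r (p₂ ++ p)) : HValid r p := by
  induction p₂ with
  | nil => exact h
  | cons x p₂ ih =>
    obtain ⟨a, s⟩ := x
    cases a
    · exact ih h.1
    · exact ih h

lemma Poppable.le_of_getElem? {r i : ℕ} {b : ℤ} {st : List (Bool × ℤ)}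
    (h : Poppable r (st.take r)) (hi : i < r) (hst : st[i]? = some (true, b)) : (r : ℤ) ≤ b :=
  h (true, b) (List.mem_of_getElem? (i := i) (by rw [List.getElem?_take, if_pos hi, hst])) rfl

lemma hValid_iff_compatible {r : ℕ} (p : Config) : HValid r p ↔ Compatible r p := by
  induction p with
  | nil => exact ⟨fun _ _ _ _ h => by simp at h, fun _ => trivial⟩
  | cons x p ih =>
    constructor
    · intro h
      refine Compatible.cons (ih.1 (HValid.of_append [x] p h)) ?_
      rintro rfl q p₁ rfl hq
      rcases hStack_append (r := r) p₁ true q with ⟨i, q₁, q₂, h12, hi, hst⟩ |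
        ⟨q₂, q₁, rfl, i, hi, hst⟩
      · have h1 := (hq q₁ q₂ h12).1
        have h2 := (hq [] q rfl).2
        have h3 := (h.2 rfl).le_of_getElem? (by omega) hst
        omega
      · have h1 : HValid r ((false, true) :: (q₁ ++ (true, true) :: p₁)) :=
          HValid.of_append ((false, true) :: q₂) _ (by simpa using h)
        have h2 := (h1.2 rfl).le_of_getElem? hi hst
        have h3 := (hq (q₂ ++ [(false, true)]) q₁ (by simp)).2
        omega
    · intro h
      have hp := ih.2 h.of_cons
      obtain ⟨a, s⟩ := x
      cases a
      · refine ⟨hp, ?_⟩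
        rintro rfl ⟨s, b⟩ he hs
        obtain ⟨i, hi⟩ := List.mem_iff_getElem?.1 he
        rw [List.getElem?_take] at hi
        split_ifs at hi with hir
        simp only at hs
        subst hs
        obtain ⟨q, p₁, rfl, rfl, hq⟩ := exists_of_hStack p i _ b hi
        by_contra hb
        obtain ⟨q₁, hq₁, rfl | ⟨q₂, rfl⟩⟩ := exists_initial_conflict q
          (fun q₁ q₂ h12 => by have := hq q₁ q₂ h12; omega) (not_le.mp hb)
        · exact h [] q p₁ rfl hq₁
        · exact h [] q₁ (q₂ ++ (true, true) :: p₁) (by simp) hq₁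
      · exact hp

lemma vValid_iff_compatible {r : ℕ} (p : Config) : VValid r p ↔ Compatible r p := by
  induction p with
  | nil => exact ⟨fun _ _ _ _ h => by simp at h, fun _ => trivial⟩
  | cons x p ih =>
    constructor
    · intro h
      refine Compatible.cons (ih.1 ?_) ?_
      · obtain ⟨a, s⟩ := x
        cases a
        · exact h.1
        · exact h
      rintro rfl q p₁ rfl hq
      obtain ⟨q₁, q₂, h12, hst⟩ := vStack_append p₁ q (fun q₁ q₂ h12 => (hq q₁ q₂ h12).2) 0
        (by have := (hq [] q rfl).2; simp; omega)
      have h1 := h.2 rfl (hSum r q₁) (by simp [List.head?_eq_getElem?, hst])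
      have h2 := (hq q₁ q₂ h12).1
      omega
    · intro h
      have hp := ih.2 h.of_cons
      obtain ⟨a, s⟩ := x
      cases a
      · refine ⟨hp, ?_⟩
        rintro rfl b hb
        rw [List.head?_eq_getElem?] at hb
        obtain ⟨q, p₁, rfl, rfl, hq, -⟩ := exists_of_vStack p 0 b hb
        by_contra hb
        obtain ⟨q₁, hq₁, rfl | ⟨q₂, rfl⟩⟩ := exists_final_conflict q hq (not_le.mp hb)
        · exact h [] q p₁ rfl hq₁
        · exact h ((false, true) :: q₂) q₁ p₁ (by simp) hq₁
      · exact hp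

section Sums

variable {K : Type*} [Field K]

open Classical in
/-- Weighted sum over all ways to extend the configuration `p` by the letters of a word to a
configuration satisfying `P`. -/
noncomputable def configSum (r : ℕ) (a b : K) (P : Config → Prop) : List Bool → Config → K
  | [], p => if P p then 1 else 0
  | true :: w, p => a⁻¹ * (configSum r a b P w ((true, false) :: p) +
      b ^ r * configSum r a b P w ((true, true) :: p))
  | false :: w, p => b⁻¹ * (configSum r a b P w ((false, false) :: p) +
      a ^ r * configSum r a b P w ((false, true) :: p))

/-- The generating function of a word, computed by scanning with the stack of `vStack`. -/
def vGen (r : ℕ) (a b : K) : List Bool → List ℤ → K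
  | [], _ => 1
  | true :: w, st => a⁻¹ * (vGen r a b w (st.map (· + 1)) +
      b ^ r * vGen r a b w (List.replicate r 0 ++ st.map (· + 1)))
  | false :: w, [] => b⁻¹ * ((1 + a ^ r) * vGen r a b w [])
  | false :: w, c :: st => b⁻¹ * (vGen r a b w st +
      if (r : ℤ) ≤ c then a ^ r * vGen r a b w (st.map (· + (-r : ℤ))) else 0)

/-- Remove `m` entries of a stack, deciding for each one whether it is selected. -/
def popSum (r : ℕ) (b : K) : ℕ → List ℤ → (List ℤ → K) → K
  | 0, st, k => k st
  | _ + 1, [], k => k []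
  | m + 1, c :: st, k => popSum r b m st k +
      if (r : ℤ) ≤ c then b ^ r * popSum r b m (st.map (· + (-r : ℤ))) k else 0

/-- The generating function of a word, computed by scanning with the stack of `hStack` where the
selection of a horizontal letter is decided when it is matched. -/
def hGen (r : ℕ) (a b : K) : List Bool → List ℤ → K
  | [], st => (1 + b ^ r) ^ st.length
  | true :: w, st => a⁻¹ * hGen r a b w (0 :: st)
  | false :: w, st => b⁻¹ * (hGen r a b w (st.map (· + 1)) +
      a ^ r * popSum r b r st fun st' => hGen r a b w (st'.map (· + 1)))

open Classical in
/-- The generating function of a word, computed by scanning with the stack of `hStack`. -/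
noncomputable def flaggedGen (r : ℕ) (a b : K) : List Bool → List (Bool × ℤ) → K
  | [], _ => 1
  | true :: w, st => a⁻¹ * (flaggedGen r a b w ((false, 0) :: st) +
      b ^ r * flaggedGen r a b w ((true, 0) :: shift (-r) st))
  | false :: w, st => b⁻¹ * (flaggedGen r a b w (shift 1 st) +
      a ^ r * if Poppable r (st.take r) then flaggedGen r a b w (shift 1 (st.drop r)) else 0)

/-- Sum over all choices of flags on a stack. -/
def flagSum (r : ℕ) (b : K) : List ℤ → (List (Bool × ℤ) → K) → K
  | [], k => k []
  | c :: st, k => flagSum r b st (fun s => k ((false, c) :: s)) +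
      b ^ r * flagSum r b st (fun s => k ((true, c) :: shift (-r) s))

lemma configSum_congr (r : ℕ) (a b : K) {P Q : Config → Prop} (h : ∀ p, P p ↔ Q p)
    (w : List Bool) (p : Config) : configSum r a b P w p = configSum r a b Q w p := by
  rw [show P = Q from funext fun p => propext (h p)]

lemma configSum_eq_zero (r : ℕ) (a b : K) {P : Config → Prop} (h : ∀ x p, P (x :: p) → P p)
    (w : List Bool) (p : Config) (hp : ¬ P p) : configSum r a b P w p = 0 := by
  induction w generalizing p with
  | nil => simp [configSum, hp]
  | cons x w ih =>
    cases x <;> simp [configSum, ih _ fun hp' => hp (h _ _ hp')]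

lemma VValid.of_cons {r : ℕ} (x : Bool × Bool) (p : Config) (h : VValid r (x :: p)) :
    VValid r p := by
  rw [vValid_iff_compatible] at *
  exact h.of_cons

lemma HValid.of_cons {r : ℕ} (x : Bool × Bool) (p : Config) (h : HValid r (x :: p)) :
    HValid r p :=
  HValid.of_append [x] p h

lemma configSum_vValid (r : ℕ) (a b : K) (w : List Bool) (p : Config) (hp : VValid r p) :
    configSum r a b (VValid r) w p = vGen r a b w (vStack r p) := by
  induction w generalizing p with
  | nil => simp [configSum, vGen, hp]
  | cons x w ih =>
    cases x
    · have h0 := ih ((false, false) :: p) ⟨hp, by simp⟩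
      rw [configSum, h0]
      by_cases hh : HeadLarge r (vStack r p)
      · rw [ih ((false, true) :: p) ⟨hp, fun _ => hh⟩]
        cases hs : vStack r p with
        | nil => simp [vStack, hs, vGen, add_mul]
        | cons c st =>
          have : (r : ℤ) ≤ c := hh c (by simp [hs])
          simp [vStack, hs, vGen, hWeight, this]
      · rw [configSum_eq_zero r a b VValid.of_cons w ((false, true) :: p) fun h => hh (h.2 rfl)]
        cases hs : vStack r p with
        | nil => simp [HeadLarge, hs] at hh
        | cons c st =>
          simp only [HeadLarge, hs, List.head?_cons, Option.mem_some_iff, forall_eq'] at hh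
          simp [vStack, hs, vGen, hWeight, hh]
    · rw [configSum, ih ((true, false) :: p) hp, ih ((true, true) :: p) hp]
      simp [vStack, vGen]

lemma configSum_hValid (r : ℕ) (a b : K) (w : List Bool) (p : Config) (hp : HValid r p) :
    configSum r a b (HValid r) w p = flaggedGen r a b w (hStack r p) := by
  induction w generalizing p with
  | nil => simp [configSum, flaggedGen, hp]
  | cons x w ih =>
    cases x
    · have h0 := ih ((false, false) :: p) ⟨hp, by simp⟩
      rw [configSum, h0, flaggedGen]
      by_cases hh : Poppable r ((hStack r p).take r)
      · rw [ih ((false, true) :: p) ⟨hp, fun _ => hh⟩]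
        simp [hStack, hh]
      · rw [configSum_eq_zero r a b HValid.of_cons w ((false, true) :: p) fun h => hh (h.2 rfl)]
        simp [hStack, hh]
    · rw [configSum, ih ((true, false) :: p) hp, ih ((true, true) :: p) hp]
      simp [hStack, flaggedGen, vWeight, shift]

lemma shift_comm (c d : ℤ) (st : List (Bool × ℤ)) :
    shift c (shift d st) = shift d (shift c st) := by
  simp [shift, add_right_comm]

lemma flagSum_map (r : ℕ) (b : K) (c : ℤ) (st : List ℤ) (k : List (Bool × ℤ) → K) :
    flagSum r b (st.map (· + c)) k = flagSum r b st fun s => k (shift c s) := by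
  induction st generalizing k with
  | nil => rfl
  | cons d st ih =>
    simp only [List.map_cons, flagSum, ih, shift_comm (-r : ℤ) c]
    rfl

lemma flagSum_add (r : ℕ) (b : K) (st : List ℤ) (k l : List (Bool × ℤ) → K) :
    flagSum r b st (fun s => k s + l s) = flagSum r b st k + flagSum r b st l := by
  induction st generalizing k l with
  | nil => rfl
  | cons c st ih =>
    simp only [flagSum, ih]
    ring

lemma flagSum_mul (r : ℕ) (b : K) (st : List ℤ) (c : K) (k : List (Bool × ℤ) → K) :
    flagSum r b st (fun s => c * k s) = c * flagSum r b st k := by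
  induction st generalizing k with
  | nil => rfl
  | cons d st ih =>
    simp only [flagSum, ih]
    ring

lemma flagSum_one (r : ℕ) (b : K) (st : List ℤ) :
    flagSum r b st (fun _ => 1) = (1 + b ^ r) ^ st.length := by
  induction st with
  | nil => simp [flagSum]
  | cons d st ih =>
    rw [flagSum, ih, List.length_cons]
    ring

open Classical in
lemma popSum_flagSum (r : ℕ) (b : K) (m : ℕ) (st : List ℤ) (k : List (Bool × ℤ) → K) :
    popSum r b m st (fun st' => flagSum r b st' k) =
      flagSum r b st fun s => if Poppable r (s.take m) then k (s.drop m) else 0 := by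
  induction m generalizing st k with
  | zero => simp [popSum, Poppable]
  | succ m ih =>
    cases st with
    | nil => simp [popSum, flagSum, Poppable]
    | cons c st =>
      rw [popSum, flagSum, ih, ih, flagSum_map]
      congr 1
      · simp [Poppable]
      · split_ifs with h
        · simp [Poppable, h]
        · have := flagSum_mul r b st 0 (fun _ => 0)
          simp only [zero_mul] at this
          simp [Poppable, h, this]

lemma hGen_eq_flagSum (r : ℕ) (a b : K) (w : List Bool) (st : List ℤ) :
    hGen r a b w st = flagSum r b st (flaggedGen r a b w) := by
  induction w generalizing st with
  | nil => exact (flagSum_one r b st).symm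
  | cons x w ih =>
    cases x
    · simp only [hGen, ih, flagSum_map, popSum_flagSum, flaggedGen, flagSum_mul, flagSum_add]
    · simp only [hGen, ih, flagSum, flaggedGen, flagSum_mul, flagSum_add]

lemma hGen_eq_vGen (r : ℕ) (a b : K) (w : List Bool) : hGen r a b w [] = vGen r a b w [] := by
  have hh := configSum_hValid r a b w [] trivial
  have hv := configSum_vValid r a b w [] trivial
  rw [configSum_congr r a b (fun p =>
    (hValid_iff_compatible p).trans (vValid_iff_compatible p).symm), hv] at hh
  rw [hGen_eq_flagSum]
  exact hh.symm

lemma hGen_replicate (r : ℕ) (a b : K) (n : ℕ) (w : List Bool) (st : List ℤ) :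
    hGen r a b (List.replicate n true ++ w) st =
      a⁻¹ ^ n * hGen r a b w (List.replicate n 0 ++ st) := by
  induction n generalizing st with
  | zero => simp
  | succ n ih =>
    rw [List.replicate_succ, List.cons_append, hGen, ih, pow_succ', mul_assoc,
      List.replicate_succ', List.append_assoc]
    rfl

lemma popSum_replicate {r : ℕ} (hr : 0 < r) (b : K) (n m : ℕ) (st : List ℤ)
    (k : List ℤ → K) : popSum r b (n + m) (List.replicate n 0 ++ st) k = popSum r b m st k := by
  induction n with
  | zero => simp
  | succ n ih =>
    rw [List.replicate_succ, List.cons_append, Nat.add_right_comm, popSum, ih, if_neg (by omega),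
      add_zero]

/-- The word obtained from a list by `false ↦ H`, `true ↦ HV`. -/
def shortWord (e : List Bool) : List Bool :=
  e.flatMap fun c => if c then [true, false] else [true]

/-- The word obtained from a list by `false ↦ H ^ r V`, `true ↦ H ^ (r - 1) V`. -/
def longWord (r : ℕ) (e : List Bool) : List Bool :=
  e.flatMap fun c => List.replicate (if c then r - 1 else r) true ++ [false]

lemma hGen_longWord {r : ℕ} (hr : 0 < r) {x₁ x₂ x₃ : K} (h₁ : x₁ ≠ 0) (h₂ : x₂ ≠ 0)
    (h₃ : x₃ ≠ 0) (h : x₃ * x₁ = 1 + x₂ ^ r) (e : List Bool) (st : List ℤ) :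
    hGen r x₁ x₂ (longWord r e) (st.map (· + 1)) =
      (x₃ * x₁) ^ st.length * vGen r x₂ x₃ (shortWord e) st := by
  induction e generalizing st with
  | nil => simp [longWord, shortWord, hGen, vGen, h]
  | cons c e ih =>
    cases c
    · have hl : longWord r (false :: e) =
          List.replicate r true ++ false :: longWord r e := by simp [longWord]
      have hs : shortWord (false :: e) = true :: shortWord e := by simp [shortWord]
      have hp := popSum_replicate hr x₂ r 0 (st.map (· + 1))
        (fun st' => hGen r x₁ x₂ (longWord r e) (st'.map (· + 1)))
      rw [add_zero, popSum] at hp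
      rw [hl, hs, hGen_replicate, hGen, hp, ih, ih, vGen]
      simp only [List.length_append, List.length_replicate, List.length_map, inv_pow]
      field_simp
      ring
    · obtain ⟨n, rfl⟩ : ∃ n, r = n + 1 := ⟨r - 1, by omega⟩
      have hl : longWord (n + 1) (true :: e) =
          List.replicate n true ++ false :: longWord (n + 1) e := by simp [longWord]
      have hs : shortWord (true :: e) = true :: false :: shortWord e := by simp [shortWord]
      rw [hl, hs, hGen_replicate, hGen, popSum_replicate hr x₂ n 1, ih, vGen,
        List.replicate_succ, List.cons_append, vGen, if_neg (by omega)]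
      cases st with
      | nil =>
        have := ih []
        simp only [List.map_nil, List.length_nil, pow_zero, one_mul] at this
        simp only [List.map_nil, popSum, this, vGen, List.append_nil, List.length_replicate,
          List.length_nil, inv_pow, ← h]
        field_simp
        ring
      | cons c st =>
        simp only [List.map_cons, popSum, ih, vGen, List.length_append, List.length_replicate,
          List.length_cons, List.length_map, inv_pow]
        split_ifs <;> field_simp <;> ring

/-- The list whose short word is the long word of the given one. -/
def nextList (r : ℕ) (e : List Bool) : List Bool :=
  e.flatMap fun c => List.replicate (if c then r - 2 else r - 1) false ++ [true]

lemma shortWord_nextList {r : ℕ} (hr : 2 ≤ r) (e : List Bool) :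
    shortWord (nextList r e) = longWord r e := by
  obtain ⟨n, rfl⟩ : ∃ n, r = n + 2 := ⟨r - 2, by omega⟩
  have hrep : ∀ n, shortWord (List.replicate n false ++ [true]) =
      List.replicate (n + 1) true ++ [false] := by
    intro n
    induction n with
    | zero => simp [shortWord]
    | succ n ih =>
      rw [List.replicate_succ, List.replicate_succ, List.cons_append, List.cons_append, ← ih]
      simp [shortWord]
  simp only [nextList, longWord, shortWord, List.flatMap_assoc] at hrep ⊢
  congr 1
  funext c
  cases c <;> simpa using hrep _

lemma eq_vGen {r : ℕ} (hr : 2 ≤ r) (k : ℕ) (u : ℤ → K) (hne : ∀ n, u n ≠ 0)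
    (hrec : ∀ n, u (n + 1) * u (n - 1) = 1 + u n ^ r) :
    u (k + 2) = vGen r (u 0) (u 1) (shortWord ((nextList r)^[k] [false])) [] := by
  induction k generalizing u with
  | zero =>
    have h := hrec 1
    norm_num at h
    simp only [Function.iterate_zero, id, shortWord, vGen, List.flatMap_cons, List.flatMap_nil,
      Bool.false_eq_true, if_false, List.append_nil, mul_one, ← h]
    have := hne 0
    norm_num
    field_simp
  | succ k ih =>
    have h := hrec 1
    norm_num at h
    have hk := ih (fun n => u (n + 1)) (fun n => hne _) fun n => by
      have := hrec (n + 1)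
      rwa [show n + 1 - 1 = n - 1 + 1 by ring] at this
    have hl := hGen_longWord (by omega : 0 < r) (hne 0) (hne 1) (hne 2) h
      ((nextList r)^[k] [false]) []
    rw [Function.iterate_succ_apply', shortWord_nextList hr, ← hGen_eq_vGen]
    norm_num at hk hl
    rw [hl, ← hk]
    push_cast
    congr 1

/-- Laurent polynomials in `x` and `y` with coefficients in `ℕ`. -/
def IsLaurent (x y z : K) : Prop :=
  ∃ m : ℤ × ℤ →₀ ℕ, z = ∑ p ∈ m.support, (m p : K) * x ^ p.1 * y ^ p.2

lemma isLaurent_iff {x y z : K} :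
    IsLaurent x y z ↔
      ∃ m : ℤ × ℤ →₀ ℕ, z = m.sum fun p c => (c : K) * (x ^ p.1 * y ^ p.2) := by
  simp only [IsLaurent, Finsupp.sum, mul_assoc]

lemma IsLaurent.zero (x y : K) : IsLaurent x y 0 := ⟨0, by simp⟩

lemma IsLaurent.monomial (x y : K) (i j : ℤ) : IsLaurent x y (x ^ i * y ^ j) :=
  isLaurent_iff.2 ⟨Finsupp.single (i, j) 1, by rw [Finsupp.sum_single_index] <;> simp⟩

lemma IsLaurent.add {x y z w : K} (hz : IsLaurent x y z) (hw : IsLaurent x y w) :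
    IsLaurent x y (z + w) := by
  rw [isLaurent_iff] at *
  obtain ⟨m, rfl⟩ := hz
  obtain ⟨n, rfl⟩ := hw
  exact ⟨m + n, (Finsupp.sum_add_index' (by simp) (by intros; push_cast; ring)).symm⟩

lemma IsLaurent.swap {x y z : K} (hz : IsLaurent x y z) : IsLaurent y x z := by
  rw [isLaurent_iff] at *
  obtain ⟨m, rfl⟩ := hz
  refine ⟨m.mapDomain Prod.swap, ?_⟩
  rw [Finsupp.sum_mapDomain_index (by simp) (by intros; push_cast; ring)]
  simp [mul_comm]

lemma IsLaurent.zpow_mul {x y z : K} (hx : x ≠ 0) (i : ℤ) (hz : IsLaurent x y z) :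
    IsLaurent x y (x ^ i * z) := by
  rw [isLaurent_iff] at *
  obtain ⟨m, rfl⟩ := hz
  refine ⟨m.mapDomain fun p => (i + p.1, p.2), ?_⟩
  rw [Finsupp.sum_mapDomain_index (by simp) (by intros; push_cast; ring), Finsupp.mul_sum]
  simp only [zpow_add₀ hx]
  exact Finsupp.sum_congr fun p _ => by ring

lemma isLaurent_vGen (r : ℕ) {a b : K} (ha : a ≠ 0) (hb : b ≠ 0) (w : List Bool)
    (st : List ℤ) : IsLaurent a b (vGen r a b w st) := by
  have hA : ∀ {z : K} (i : ℤ), IsLaurent a b z → IsLaurent a b (a ^ i * z) :=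
    fun i hz => hz.zpow_mul ha i
  have hB : ∀ {z : K} (i : ℤ), IsLaurent a b z → IsLaurent a b (b ^ i * z) :=
    fun i hz => (hz.swap.zpow_mul hb i).swap
  induction w generalizing st with
  | nil => simpa [vGen] using IsLaurent.monomial a b 0 0
  | cons x w ih =>
    cases x
    · cases st with
      | nil =>
        rw [vGen, ← zpow_neg_one, ← zpow_natCast, add_mul, one_mul]
        exact hB _ ((ih _).add (hA _ (ih _)))
      | cons c st =>
        rw [vGen, ← zpow_neg_one, ← zpow_natCast]
        refine hB _ ((ih _).add ?_)
        split_ifs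
        · exact hA _ (ih _)
        · exact IsLaurent.zero a b
    · rw [vGen, ← zpow_neg_one, ← zpow_natCast]
      exact hA _ ((ih _).add (hB _ (ih _)))

lemma isLaurent_of_nonneg {r : ℕ} (hr : 2 ≤ r) (u : ℤ → K) (hne : ∀ n, u n ≠ 0)
    (hrec : ∀ n, u (n + 1) * u (n - 1) = 1 + u n ^ r) (n : ℕ) :
    IsLaurent (u 0) (u 1) (u n) := by
  rcases n with _ | _ | n
  · simpa using IsLaurent.monomial (u 0) (u 1) 1 0
  · simpa using IsLaurent.monomial (u 0) (u 1) 0 1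
  · have h := eq_vGen hr n u hne hrec
    push_cast
    rw [show (n : ℤ) + 1 + 1 = n + 2 by ring, h]
    exact isLaurent_vGen r (hne 0) (hne 1) _ _

theorem isLaurent {r : ℕ} (hr : 2 ≤ r) (u : ℤ → K) (hne : ∀ n, u n ≠ 0)
    (hrec : ∀ n, u (n + 1) * u (n - 1) = 1 + u n ^ r) (n : ℤ) :
    IsLaurent (u 0) (u 1) (u n) := by
  rcases le_or_gt 0 n with hn | hn
  · lift n to ℕ using hn
    exact isLaurent_of_nonneg hr u hne hrec n
  · obtain ⟨m, hm⟩ : ∃ m : ℕ, (m : ℤ) = 1 - n := ⟨(1 - n).toNat, by omega⟩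
    have h := isLaurent_of_nonneg hr (fun k => u (1 - k)) (fun k => hne _) (fun k => by
      have := hrec (1 - k)
      rw [mul_comm] at this
      convert this using 3 <;> ring) m
    rw [hm] at h
    simpa using h.swap

end Sums

end RankTwoPositivity

/-- Laurent positivity: if `u : ℤ → Frac(ℚ[x,y])` satisfies `u 0 = x`,
`u 1 = y`, `u n ≠ 0` and `u (n+1) * u (n-1) = 1 + (u n)^r`, then every `u n`
is a Laurent polynomial in `x, y` with nonnegative integer coefficients. -/
theorem stmt7 (r : ℕ) (hr : 2 ≤ r)
    (u : ℤ → FractionRing (MvPolynomial (Fin 2) ℚ))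
    (x y : FractionRing (MvPolynomial (Fin 2) ℚ))
    (hx : x = algebraMap (MvPolynomial (Fin 2) ℚ)
      (FractionRing (MvPolynomial (Fin 2) ℚ)) (MvPolynomial.X 0))
    (hy : y = algebraMap (MvPolynomial (Fin 2) ℚ)
      (FractionRing (MvPolynomial (Fin 2) ℚ)) (MvPolynomial.X 1))
    (h0 : u 0 = x) (h1 : u 1 = y)
    (hne : ∀ n : ℤ, u n ≠ 0)
    (hrec : ∀ n : ℤ, u (n + 1) * u (n - 1) = 1 + (u n) ^ r) :
    ∀ n : ℤ, ∃ m : ℤ × ℤ →₀ ℕ,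
      u n = ∑ p ∈ m.support, (m p : FractionRing (MvPolynomial (Fin 2) ℚ)) *
        x ^ p.1 * y ^ p.2 := by
  subst h0 h1
  exact RankTwoPositivity.isLaurent hr u hne hrec
end

section
/- Let K be the field of fractions of ℚ[x,y] and let u : ℤ → K satisfy u_0 = x, u_1 = y, u_n ≠ 0 for all n, and u_{n+1}·u_{n−1} = 1 + u_n² for all n ∈ ℤ. Then for every n ≥ 1, u_n = ∑_{(α,β)} x^{α_1+⋯+α_{n−1}} · y^{1+β_1+⋯+β_{n−1}}, where the sum runs over all admissible pairs (α,β) of functions {1,…,n−1} → {−1,+1} (for n = 1 the unique, empty, pair contributes the term y). -/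
open scoped Classical

/-- The sign `+1`/`-1` encoded by a Boolean. -/
def sg (b : Bool) : ℤ := if b then 1 else -1

/-- A pair `(α, β)` of sign sequences indexed by `{1, …, m}` (here `Fin m`,
with `i : Fin m` standing for the index `i+1`, and `true ↦ +1`, `false ↦ -1`)
is admissible if `α 1 = -1`; `α i = 1` implies `β i = -1`; and
(`α i = -1` and `α (i+1) = 1`) implies `β i = -1`. -/
def Adm (m : ℕ) (ab : (Fin m → Bool) × (Fin m → Bool)) : Prop :=
  (∀ h : 0 < m, ab.1 ⟨0, h⟩ = false) ∧
  (∀ i : Fin m, ab.1 i = true → ab.2 i = false) ∧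
  (∀ i : Fin m, ∀ h : (i : ℕ) + 1 < m,
    ab.1 i = false → ab.1 ⟨(i : ℕ) + 1, h⟩ = true → ab.2 i = false)

/-- The transition conditions of `Adm`, without the condition on the first entry of `α`. -/
def TransitionAdm {m : ℕ} (α β : Fin m → Bool) : Prop :=
  (∀ i : Fin m, α i = true → β i = false) ∧
  (∀ i : Fin m, ∀ h : (i : ℕ) + 1 < m,
    α i = false → α ⟨(i : ℕ) + 1, h⟩ = true → β i = false)

lemma transitionAdm_cons {m : ℕ} (a b : Bool) (α β : Fin (m + 1) → Bool) :
    TransitionAdm (Fin.cons a α : Fin (m + 2) → Bool) (Fin.cons b β : Fin (m + 2) → Bool) ↔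
      (a = true → b = false) ∧ (a = false → α 0 = true → b = false) ∧ TransitionAdm α β := by
  have key : ∀ (i : Fin (m + 1)) (h : (i : ℕ) + 1 + 1 < m + 2),
      (Fin.cons a α : Fin (m + 2) → Bool) ⟨(i : ℕ) + 1 + 1, h⟩ =
        α ⟨(i : ℕ) + 1, by omega⟩ := fun i h =>
    Fin.cons_succ (α := fun _ => Bool) a α ⟨(i : ℕ) + 1, by omega⟩
  have key0 : ∀ h : 0 + 1 < m + 2,
      (Fin.cons a α : Fin (m + 2) → Bool) ⟨0 + 1, h⟩ = α 0 := fun h =>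
    Fin.cons_succ (α := fun _ => Bool) a α 0
  unfold TransitionAdm
  rw [Fin.forall_fin_succ, Fin.forall_fin_succ (n := m + 1)]
  simp only [Fin.cons_zero, Fin.cons_succ, Fin.val_zero, Fin.val_succ, key, key0]
  constructor
  · rintro ⟨⟨h1, h2⟩, h3, h4⟩
    exact ⟨h1, h3 (by omega), h2, fun i h => h4 i (by omega)⟩
  · rintro ⟨h1, h3, h2, h4⟩
    exact ⟨⟨h1, h2⟩, fun _ => h3, fun i h => h4 i (by omega)⟩

lemma transitionAdm_one (α β : Fin 1 → Bool) :
    TransitionAdm α β ↔ (α 0 = true → β 0 = false) :=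
  ⟨fun h => h.1 0, fun h =>
    ⟨fun i => by rwa [Subsingleton.elim i 0], fun i hi => absurd hi (by omega)⟩⟩

/-- The weighted sum over the sign sequences of length `m + 1` satisfying the transition conditions
whose `α` starts with `c`. -/
noncomputable def transitionSum {K : Type*} [Field K] (x y : K) (m : ℕ) (c : Bool) : K :=
  ∑ α : Fin (m + 1) → Bool, ∑ β : Fin (m + 1) → Bool,
    if TransitionAdm α β ∧ α 0 = c then x ^ (∑ i, sg (α i)) * y ^ (∑ i, sg (β i)) else 0

lemma sum_cons {M : Type*} [AddCommMonoid M] {m : ℕ} (f : (Fin (m + 1) → Bool) → M) :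
    ∑ α, f α = ∑ α : Fin m → Bool, (f (Fin.cons true α) + f (Fin.cons false α)) := by
  rw [← (Fin.consEquiv (fun _ : Fin (m + 1) => Bool)).sum_comp, Fintype.sum_prod_type_right]
  simp [Fin.consEquiv]

section

variable {K : Type*} [Field K] {x y : K}

lemma transitionSum_zero_false : transitionSum x y 0 false = x⁻¹ * (y + y⁻¹) := by
  simp [transitionSum, sum_cons, transitionAdm_one, sg, mul_add]

lemma transitionSum_zero_true : transitionSum x y 0 true = x * y⁻¹ := by
  simp [transitionSum, sum_cons, transitionAdm_one, sg]

lemma transitionSum_succ_false (hx : x ≠ 0) (hy : y ≠ 0) (m : ℕ) :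
    transitionSum x y (m + 1) false =
      x⁻¹ * (y + y⁻¹) * transitionSum x y m false + x⁻¹ * y⁻¹ * transitionSum x y m true := by
  unfold transitionSum
  rw [sum_cons, Finset.mul_sum, Finset.mul_sum, ← Finset.sum_add_distrib]
  refine Finset.sum_congr rfl fun α _ => ?_
  rw [sum_cons (m := m + 1), sum_cons (m := m + 1), Finset.mul_sum, Finset.mul_sum, ← Finset.sum_add_distrib,
    ← Finset.sum_add_distrib]
  refine Finset.sum_congr rfl fun β _ => ?_
  simp only [transitionAdm_cons, Fin.sum_univ_succ (n := m + 1), Fin.cons_zero, Fin.cons_succ,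
    zpow_add₀ hx, zpow_add₀ hy]
  by_cases h : TransitionAdm α β <;> cases h' : α 0 <;> simp [h, sg] <;> ring

lemma transitionSum_succ_true (hx : x ≠ 0) (hy : y ≠ 0) (m : ℕ) :
    transitionSum x y (m + 1) true =
      x * y⁻¹ * (transitionSum x y m false + transitionSum x y m true) := by
  unfold transitionSum
  rw [sum_cons, ← Finset.sum_add_distrib, Finset.mul_sum]
  refine Finset.sum_congr rfl fun α _ => ?_
  rw [sum_cons (m := m + 1), sum_cons (m := m + 1), ← Finset.sum_add_distrib, ← Finset.sum_add_distrib, Finset.mul_sum]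
  refine Finset.sum_congr rfl fun β _ => ?_
  simp only [transitionAdm_cons, Fin.sum_univ_succ (n := m + 1), Fin.cons_zero, Fin.cons_succ,
    zpow_add₀ hx, zpow_add₀ hy]
  by_cases h : TransitionAdm α β <;> cases h' : α 0 <;> simp [h, sg] <;> ring

lemma transitionSum_linear_rec (hx : x ≠ 0) (hy : y ≠ 0) (m : ℕ) :
    transitionSum x y (m + 2) false =
      (x ^ 2 + 1 + y ^ 2) / (x * y) * transitionSum x y (m + 1) false - transitionSum x y m false := by
  rw [transitionSum_succ_false hx hy (m + 1), transitionSum_succ_true hx hy m,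
    transitionSum_succ_false hx hy m]
  field_simp
  ring

lemma sum_adm_eq_transitionSum (hy : y ≠ 0) (m : ℕ) :
    ∑ ab ∈ Finset.univ.filter (Adm (m + 1)),
        x ^ (∑ i, sg (ab.1 i)) * y ^ (1 + ∑ i, sg (ab.2 i)) =
      y * transitionSum x y m false := by
  unfold transitionSum
  rw [Finset.sum_filter, Fintype.sum_prod_type, Finset.mul_sum]
  refine Finset.sum_congr rfl fun α _ => ?_
  rw [Finset.mul_sum]
  refine Finset.sum_congr rfl fun β _ => ?_
  have h : Adm (m + 1) (α, β) ↔ TransitionAdm α β ∧ α 0 = false := by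
    simp [Adm, TransitionAdm, and_comm]
  simp only [h, zpow_add₀ hy, zpow_one, mul_ite, mul_zero, mul_left_comm y]

lemma exchange_linear_rec {u : ℕ → K} (hne : ∀ n, u n ≠ 0)
    (hrec : ∀ n, u (n + 2) * u n = 1 + u (n + 1) ^ 2) (n : ℕ) :
    u (n + 2) = (u 0 ^ 2 + 1 + u 1 ^ 2) / (u 0 * u 1) * u (n + 1) - u n := by
  have h0 := hne 0
  have h1 := hne 1
  induction n with
  | zero =>
    have h := hrec 0
    field_simp
    linear_combination h
  | succ n ih =>
    apply mul_right_cancel₀ (hne (n + 1))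
    linear_combination hrec (n + 1) - hrec n + u (n + 2) * ih

lemma exchange_eq_transitionSum {u : ℕ → K} (hne : ∀ n, u n ≠ 0)
    (hrec : ∀ n, u (n + 2) * u n = 1 + u (n + 1) ^ 2) (m : ℕ) :
    u (m + 2) = u 1 * transitionSum (u 0) (u 1) m false := by
  have h0 := hne 0
  have h1 := hne 1
  have h2 : u 2 = u 1 * transitionSum (u 0) (u 1) 0 false := by
    rw [transitionSum_zero_false]
    field_simp
    linear_combination hrec 0
  induction m using Nat.twoStepInduction with
  | zero => exact h2
  | one =>
    rw [exchange_linear_rec hne hrec 1, h2, transitionSum_succ_false h0 h1, transitionSum_zero_false,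
      transitionSum_zero_true]
    field_simp
    ring
  | more m ih ih' =>
    rw [exchange_linear_rec hne hrec (m + 2), ih, ih', transitionSum_linear_rec h0 h1]
    ring

end

/-- For `r = 2`, the cluster variable `u n` (`n ≥ 1`) is the sum over all
admissible pairs `(α, β)` of sign sequences on `{1, …, n-1}` of
`x^(α₁+⋯+α_{n-1}) y^(1+β₁+⋯+β_{n-1})`. -/
theorem stmt8
    (u : ℤ → FractionRing (MvPolynomial (Fin 2) ℚ))
    (x y : FractionRing (MvPolynomial (Fin 2) ℚ))
    (hx : x = algebraMap (MvPolynomial (Fin 2) ℚ)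
      (FractionRing (MvPolynomial (Fin 2) ℚ)) (MvPolynomial.X 0))
    (hy : y = algebraMap (MvPolynomial (Fin 2) ℚ)
      (FractionRing (MvPolynomial (Fin 2) ℚ)) (MvPolynomial.X 1))
    (h0 : u 0 = x) (h1 : u 1 = y)
    (hne : ∀ n : ℤ, u n ≠ 0)
    (hrec : ∀ n : ℤ, u (n + 1) * u (n - 1) = 1 + (u n) ^ 2) :
    ∀ n : ℕ, 1 ≤ n →
      u n = ∑ ab ∈ Finset.univ.filter (Adm (n - 1)),
        x ^ (∑ i : Fin (n - 1), sg (ab.1 i)) *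
          y ^ (1 + ∑ i : Fin (n - 1), sg (ab.2 i)) := by
  intro n hn
  have hx0 : x ≠ 0 := h0 ▸ hne 0
  have hy0 : y ≠ 0 := h1 ▸ hne 1
  obtain _ | _ | m := n
  · omega
  · have hadm : Finset.univ.filter (Adm 0) = Finset.univ :=
      Finset.filter_true_of_mem fun ab _ =>
        ⟨fun h => absurd h (lt_irrefl 0), fun i => i.elim0, fun i => i.elim0⟩
    simp [hadm, h1]
  · have key := exchange_eq_transitionSum (u := fun k : ℕ => u k) (fun k => hne k)
      (fun k => by
        have h := hrec (k + 1)
        rw [add_sub_cancel_right, add_assoc, one_add_one_eq_two] at h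
        exact_mod_cast h) m
    simp only [Nat.cast_zero, Nat.cast_one, h0, h1] at key
    exact key.trans (sum_adm_eq_transitionSum hy0 m).symm
end

section
/- Let n ≥ 2. For integers p ≥ 1 and q ≥ 0, the number of admissible pairs (α,β) of functions {1,…,n−1} → {−1,+1} such that exactly p indices i satisfy α_i = 1 and exactly q indices i satisfy β_i = 1 equals C(n−2−q, p) · C(n−1−p, q), where C(a,b) is the natural-number binomial coefficient (C(a,b) = 0 when b > a) and the subtraction n−2−q is truncated at 0. Moreover, for p = 0 (i.e. α_i = −1 for all i), the number of such pairs equals C(n−1, q). -/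
open scoped Classical

/-- Admissibility of a pair of sign sequences, where the condition that `α` starts with `-1`
is imposed only when `c = true`. -/
def AdmFrom (c : Bool) (m : ℕ) (ab : (Fin m → Bool) × (Fin m → Bool)) : Prop :=
  (c = true → ∀ h : 0 < m, ab.1 ⟨0, h⟩ = false) ∧
  (∀ i : Fin m, ab.1 i = true → ab.2 i = false) ∧
  (∀ i : Fin m, ∀ h : (i : ℕ) + 1 < m,
    ab.1 i = false → ab.1 ⟨(i : ℕ) + 1, h⟩ = true → ab.2 i = false)

theorem admFrom_true (m : ℕ) (ab : (Fin m → Bool) × (Fin m → Bool)) :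
    AdmFrom true m ab ↔ Adm m ab := by
  simp [AdmFrom, Adm]

theorem admFrom_cons (c : Bool) (m : ℕ) (a b : Bool) (α β : Fin m → Bool) :
    AdmFrom c (m + 1) (Fin.cons a α, Fin.cons b β) ↔
      (c = true → a = false) ∧ (a = true → b = false) ∧ AdmFrom b m (α, β) := by
  have key : (∀ h : 0 < m, a = false → α ⟨0, h⟩ = true → b = false) ∧ (a = true → b = false) ↔
      (b = true → ∀ h : 0 < m, α ⟨0, h⟩ = false) ∧ (a = true → b = false) := by
    cases a <;> cases b <;> simp
  have hsucc : ∀ (k : ℕ) (h : k + 1 < m + 1),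
      (Fin.cons a α : Fin (m + 1) → Bool) ⟨k + 1, h⟩ = α ⟨k, Nat.lt_of_succ_lt_succ h⟩ :=
    fun k h => rfl
  have hzero : ∀ h : 0 < m + 1, (Fin.cons a α : Fin (m + 1) → Bool) ⟨0, h⟩ = a := fun _ => rfl
  simp only [AdmFrom, Fin.forall_fin_succ, Fin.cons_zero, Fin.cons_succ, hsucc, hzero,
    Fin.val_zero, Fin.val_succ, Nat.add_lt_add_iff_right, Nat.succ_pos, forall_true_left]
  tauto

theorem card_filter_cons_eq_true (m : ℕ) (a : Bool) (α : Fin m → Bool) :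
    (Finset.univ.filter fun i => (Fin.cons a α : Fin (m + 1) → Bool) i = true).card =
      a.toNat + (Finset.univ.filter fun i => α i = true).card := by
  simp only [Finset.card_filter, Fin.sum_univ_succ, Fin.cons_zero, Fin.cons_succ]
  cases a <;> simp

/-- The number of pairs satisfying `AdmFrom c m` with `p` values `+1` in the first sequence
and `q` values `+1` in the second. -/
noncomputable def admCount (c : Bool) (m p q : ℕ) : ℕ :=
  (Finset.univ.filter fun ab : (Fin m → Bool) × (Fin m → Bool) =>
    AdmFrom c m ab ∧
    (Finset.univ.filter fun i => ab.1 i = true).card = p ∧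
    (Finset.univ.filter fun i => ab.2 i = true).card = q).card

theorem admCount_zero (c : Bool) (p q : ℕ) :
    admCount c 0 p q = if p = 0 ∧ q = 0 then 1 else 0 := by
  by_cases h : p = 0 ∧ q = 0
  · simp [admCount, AdmFrom, h]
  · rw [if_neg h, admCount, Finset.card_eq_zero, Finset.filter_eq_empty_iff]
    rintro ab - ⟨-, hp, hq⟩
    exact h ⟨by simpa using hp.symm, by simpa using hq.symm⟩

theorem sum_fin_succ_arrow_bool (m : ℕ) (F : (Fin (m + 1) → Bool) → ℕ) :
    ∑ f, F f = ∑ a : Bool, ∑ α : Fin m → Bool, F (Fin.cons a α) := by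
  rw [← (Fin.consEquiv fun _ : Fin (m + 1) => Bool).sum_comp, Fintype.sum_prod_type]
  rfl

theorem admCount_succ (c : Bool) (m p q : ℕ) :
    admCount c (m + 1) p q =
      ∑ a : Bool, ∑ b : Bool, if (c = true → a = false) ∧ (a = true → b = false) then
        (Finset.univ.filter fun ab : (Fin m → Bool) × (Fin m → Bool) =>
          AdmFrom b m ab ∧
          a.toNat + (Finset.univ.filter fun i => ab.1 i = true).card = p ∧
          b.toNat + (Finset.univ.filter fun i => ab.2 i = true).card = q).card else 0 := by
  rw [admCount, Finset.card_filter, Fintype.sum_prod_type, sum_fin_succ_arrow_bool]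
  refine Finset.sum_congr rfl fun a _ => ?_
  simp_rw [sum_fin_succ_arrow_bool]
  rw [Finset.sum_comm]
  refine Finset.sum_congr rfl fun b _ => ?_
  simp only [admFrom_cons, card_filter_cons_eq_true]
  split_ifs with h
  · rw [Finset.card_filter, Fintype.sum_prod_type]
    refine Finset.sum_congr rfl fun α _ => Finset.sum_congr rfl fun β _ => ?_
    simp only [eq_true h.1, eq_true h.2, true_and]
  · refine Finset.sum_eq_zero fun α _ => Finset.sum_eq_zero fun β _ => if_neg ?_
    tauto

theorem admCount_true_succ_zero (m p : ℕ) :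
    admCount true (m + 1) p 0 = admCount false m p 0 := by
  rw [admCount_succ]
  simp [admCount]

theorem admCount_true_succ_succ (m p q : ℕ) :
    admCount true (m + 1) p (q + 1) = admCount true m p q + admCount false m p (q + 1) := by
  rw [admCount_succ]
  simp [admCount, add_comm 1]

theorem admCount_false_succ_zero (m q : ℕ) :
    admCount false (m + 1) 0 q = admCount true (m + 1) 0 q := by
  simp [admCount_succ, add_comm 1]

theorem admCount_false_succ_succ (m p q : ℕ) :
    admCount false (m + 1) (p + 1) q =
      admCount false m p q + admCount true (m + 1) (p + 1) q := by
  rw [admCount_succ, admCount_succ]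
  simp [admCount, add_comm 1]

theorem admCount_eq (m : ℕ) :
    (∀ q, admCount true m 0 q = m.choose q) ∧
    (∀ p q, admCount true m (p + 1) q =
      (m - 1 - q).choose (p + 1) * (m - (p + 1)).choose q) ∧
    (∀ p q, admCount false m p q = (m - q).choose p * (m - p).choose q) := by
  induction m with
  | zero =>
    refine ⟨fun q => ?_, fun p q => ?_, fun p q => ?_⟩
    · cases q <;> simp [admCount_zero]
    · simp [admCount_zero]
    · cases p <;> cases q <;> simp [admCount_zero]
  | succ m ih =>
    obtain ⟨ih₀, ih₁, ih₂⟩ := ih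
    have h₀ : ∀ q, admCount true (m + 1) 0 q = (m + 1).choose q := by
      intro q
      cases q with
      | zero => simp [admCount_true_succ_zero, ih₂]
      | succ q => simp [admCount_true_succ_succ, ih₀, ih₂, Nat.choose_succ_succ]
    have h₁ : ∀ p q, admCount true (m + 1) (p + 1) q =
        (m + 1 - 1 - q).choose (p + 1) * (m + 1 - (p + 1)).choose q := by
      intro p q
      cases q with
      | zero => simp [admCount_true_succ_zero, ih₂]
      | succ q =>
        rw [admCount_true_succ_succ, ih₁, ih₂, Nat.add_sub_cancel, Nat.add_sub_add_right,
          show m - 1 - q = m - (q + 1) by lia]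
        rcases le_or_gt (p + 1) m with h | h
        · rw [show m - p = m - (p + 1) + 1 by lia, Nat.choose_succ_succ]
          ring
        · simp [Nat.choose_eq_zero_of_lt (show m - (q + 1) < p + 1 by lia)]
    refine ⟨h₀, h₁, fun p q => ?_⟩
    cases p with
    | zero => simp [admCount_false_succ_zero, h₀]
    | succ p =>
      rw [admCount_false_succ_succ, h₁, ih₂, Nat.add_sub_cancel, Nat.add_sub_add_right]
      rcases le_or_gt q m with h | h
      · rw [show m + 1 - q = m - q + 1 by lia, Nat.choose_succ_succ]
        ring
      · simp [Nat.choose_eq_zero_of_lt (show m - p < q by lia)]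

/-- The number of admissible pairs `(α, β)` on `{1, …, n-1}` with exactly `p`
indices `i` with `α i = +1` and exactly `q` indices with `β i = +1` is
`C(n-2-q, p) * C(n-1-p, q)` when `p ≥ 1`, and `C(n-1, q)` when `p = 0`. -/
theorem stmt10 (n p q : ℕ) (hn : 2 ≤ n) :
    (1 ≤ p →
      (Finset.univ.filter
        (fun ab : (Fin (n - 1) → Bool) × (Fin (n - 1) → Bool) =>
          Adm (n - 1) ab ∧
          (Finset.univ.filter fun i => ab.1 i = true).card = p ∧
          (Finset.univ.filter fun i => ab.2 i = true).card = q)).card =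
        (n - 2 - q).choose p * (n - 1 - p).choose q) ∧
    ((Finset.univ.filter
        (fun ab : (Fin (n - 1) → Bool) × (Fin (n - 1) → Bool) =>
          Adm (n - 1) ab ∧
          (Finset.univ.filter fun i => ab.1 i = true).card = 0 ∧
          (Finset.univ.filter fun i => ab.2 i = true).card = q)).card =
      (n - 1).choose q) := by
  obtain ⟨h₀, h₁, -⟩ := admCount_eq (n - 1)
  simp only [admCount, admFrom_true] at h₀ h₁
  refine ⟨fun hp => ?_, h₀ q⟩
  obtain ⟨p, rfl⟩ := Nat.exists_eq_add_of_le' hp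
  exact h₁ p q
end

section
/- For all integers n ≥ 2, p ≥ 1 and q ≥ 0, ∑_{t=1}^{p} C(n−1−p−t, q) · C(p−1, t−1) · C(n−1−p, t) = C(n−2−q, p) · C(n−1−p, q), where C(a,b) denotes the natural-number binomial coefficient (C(a,b) = 0 when b > a) and all subtractions are truncated at 0 (note that whenever a truncation occurs in a summand, the companion factor C(n−1−p, t) or C(n−2−q, p) vanishes, so the identity is unambiguous). -/
theorem choose_mul_choose_sub_comm (m s t : ℕ) :
    m.choose s * (m - s).choose t = m.choose t * (m - t).choose s := by
  have hs := Nat.choose_mul (n := m) (Nat.le_add_right s t)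
  have ht := Nat.choose_mul (n := m) (Nat.le_add_left t s)
  rw [Nat.add_sub_cancel_left] at hs
  rw [Nat.add_sub_cancel] at ht
  rw [← hs, ← ht, Nat.choose_symm_add]

/-- A form of the Vandermonde convolution. -/
theorem sum_Icc_choose_mul_choose_pred (a k : ℕ) (hk : 1 ≤ k) :
    ∑ t ∈ Finset.Icc 1 k, (k - 1).choose (t - 1) * a.choose t = (a + (k - 1)).choose k := by
  obtain ⟨k, rfl⟩ := Nat.exists_eq_add_of_le' hk
  rw [Nat.add_choose_eq, Finset.Nat.sum_antidiagonal_eq_sum_range_succ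
    (fun i j => a.choose i * (k + 1 - 1).choose j), Finset.sum_range_succ',
    ← Finset.Ico_add_one_right_eq_Icc, Finset.sum_Ico_eq_sum_range]
  simp only [Nat.add_sub_cancel, Nat.sub_zero, Nat.choose_succ_self, mul_zero, add_zero]
  refine Finset.sum_congr rfl fun i hi => ?_
  rw [Nat.add_sub_cancel_left, Nat.add_sub_add_right,
    Nat.choose_symm (Nat.lt_succ_iff.mp (Finset.mem_range.mp hi)), add_comm 1 i, mul_comm]

/-- The binomial identity
`∑_{t=1}^{p} C(n-1-p-t, q) C(p-1, t-1) C(n-1-p, t) = C(n-2-q, p) C(n-1-p, q)`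
(natural-number binomial coefficients, truncated subtraction). -/
theorem stmt13 (n p q : ℕ) (hn : 2 ≤ n) (hp : 1 ≤ p) :
    ∑ t ∈ Finset.Icc 1 p,
        (n - 1 - p - t).choose q * (p - 1).choose (t - 1) * (n - 1 - p).choose t =
      (n - 2 - q).choose p * (n - 1 - p).choose q := by
  have hsum : ∑ t ∈ Finset.Icc 1 p,
        (n - 1 - p - t).choose q * (p - 1).choose (t - 1) * (n - 1 - p).choose t =
      (n - 1 - p - q + (p - 1)).choose p * (n - 1 - p).choose q := by
    rw [← sum_Icc_choose_mul_choose_pred _ _ hp, Finset.sum_mul]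
    refine Finset.sum_congr rfl fun t _ => ?_
    linear_combination (p - 1).choose (t - 1) * choose_mul_choose_sub_comm (n - 1 - p) t q
  rw [hsum]
  obtain hq | hq := lt_or_ge (n - 1 - p) q
  · simp [Nat.choose_eq_zero_of_lt hq]
  · obtain hpn | hpn := le_or_gt p (n - 1)
    · congr 2
      omega
    · rw [Nat.choose_eq_zero_of_lt (by omega : n - 1 - p - q + (p - 1) < p),
        Nat.choose_eq_zero_of_lt (by omega : n - 2 - q < p)]
end
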